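/- Let (Λ_Q, f) be a C^{1+Lip} expansive and transitive Markov system. A point x ∈ Λ_Q belongs to Λ_Q \ H if and only if there exists k ≥ 0 such that f^k(x) is a parabolic periodic point of f. -/

import Mathlib

open Set Metric Filter MeasureTheory
open scoped Classical

/-- The word `[ω 0, ω 1, …, ω (n-1)]` read off from the sequence `ω`. -/
def wordOf {p : ℕ} (ω : ℕ → Fin p) (n : ℕ) : List (Fin p) :=
  (List.range n).map ω

/-- The cylinder sets `Δ_{i₁…iₙ} = g_{i₁…i_{n-1}}(I_{iₙ})` of the iterated function
system given by the big interval `I`, the subintervals `Isub i` and the maps `g i`;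
by convention `Δ_∅ = I`. -/
def cylOf {p : ℕ} (I : Set ℝ) (Isub : Fin p → Set ℝ) (g : Fin p → ℝ → ℝ) :
    List (Fin p) → Set ℝ
  | [] => I
  | [i] => Isub i
  | i :: j :: w => g i '' cylOf I Isub g (j :: w)

/-- The sequence `ω` contains the word `w` as a sub-word starting at position `n`. -/
def containsAt {p : ℕ} (ω : ℕ → Fin p) (w : List (Fin p)) (n : ℕ) : Prop :=
  ∀ k : ℕ, (hk : k < w.length) → ω (n + k) = w.get ⟨k, hk⟩

/-- The sequence `ω` belongs to `Σ_Q`, i.e. it contains no word of `Q` as a sub-word. -/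
def avoids {p : ℕ} (Q : Finset (List (Fin p))) (ω : ℕ → Fin p) : Prop :=
  ∀ w ∈ Q, ∀ n : ℕ, ¬ containsAt ω w n

/-- The limit set `Λ_Q = π(Σ_Q)`: points lying, for some `ω ∈ Σ_Q`, in all the
cylinders `Δ_{ω₀…ω_{n-1}}`. -/
def limitSetOf {p : ℕ} (I : Set ℝ) (Isub : Fin p → Set ℝ) (g : Fin p → ℝ → ℝ)
    (Q : Finset (List (Fin p))) : Set ℝ :=
  { x | ∃ ω : ℕ → Fin p, avoids Q ω ∧ ∀ n : ℕ, x ∈ cylOf I Isub g (wordOf ω n) }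

/-- `gIter g ω n = g_{i_n … i_1} = g_{ω (n-1)} ∘ ⋯ ∘ g_{ω 0}`. -/
def gIter {p : ℕ} (g : Fin p → ℝ → ℝ) (ω : ℕ → Fin p) : ℕ → ℝ → ℝ
  | 0 => id
  | n + 1 => g (ω n) ∘ gIter g ω n

/-- The derivative of the composition `gIter g ω n` at `x` (chain rule product). -/
noncomputable def gIterDer {p : ℕ} (g gder : Fin p → ℝ → ℝ) (ω : ℕ → Fin p)
    (n : ℕ) (x : ℝ) : ℝ :=
  ∏ k ∈ Finset.range n, gder (ω k) (gIter g ω k x)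

/-- Prepending the finite word `w` to the infinite sequence `ω`. -/
def prependWord {p : ℕ} (w : List (Fin p)) (ω : ℕ → Fin p) : ℕ → Fin p :=
  fun n => if h : n < w.length then w.get ⟨n, h⟩ else ω (n - w.length)

/-- `l(Σ_Q)`: the minimum, over all finite sets `Q'` of words with `Σ_{Q'} = Σ_Q`,
of the maximal length `l(Q')` of words of `Q'`. -/
noncomputable def minRepLen {p : ℕ} (Q : Finset (List (Fin p))) : ℕ :=
  sInf { n : ℕ | ∃ Q' : Finset (List (Fin p)),
    (∀ ω : ℕ → Fin p, avoids Q' ω ↔ avoids Q ω) ∧ Q'.sup List.length = n }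

/-- A `C^{1+Lip}` expansive and transitive Markov system `(Λ_Q, f)`. -/
structure ExpansiveMarkovSystem (p : ℕ) where
  /-- the alphabet is nonempty -/
  hp : 0 < p
  /-- the ambient closed interval `I` -/
  I : Set ℝ
  hI : ∃ a b : ℝ, a < b ∧ I = Set.Icc a b
  /-- the pairwise disjoint closed subintervals `I₁, …, I_p` -/
  Isub : Fin p → Set ℝ
  hIsub : ∀ i, ∃ a b : ℝ, a < b ∧ Isub i = Set.Icc a b
  hsubI : ∀ i, Isub i ⊆ I
  hdisj : ∀ i j, i ≠ j → Disjoint (Isub i) (Isub j)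
  /-- the contractions `g i`, defined on `⋃ j, Isub j` -/
  g : Fin p → ℝ → ℝ
  /-- the derivative of `g i` on `⋃ j, Isub j` -/
  gder : Fin p → ℝ → ℝ
  hg_inj : ∀ i, Set.InjOn (g i) (⋃ j, Isub j)
  hg_range : ∀ i, g i '' (⋃ j, Isub j) ⊆ interior (Isub i)
  hg_deriv : ∀ i, ∀ x ∈ ⋃ j, Isub j,
    HasDerivWithinAt (g i) (gder i x) (⋃ j, Isub j) x
  hgder_ne : ∀ i, ∀ x ∈ ⋃ j, Isub j, gder i x ≠ 0
  hgder_cont : ∀ i, ContinuousOn (gder i) (⋃ j, Isub j)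
  /-- `log |g i'|` is Lipschitz on the domain -/
  hgder_lip : ∀ i, ∃ θ : ℝ, ∀ x ∈ ⋃ j, Isub j, ∀ y ∈ ⋃ j, Isub j,
    abs (Real.log (abs (gder i x)) - Real.log (abs (gder i y))) ≤ θ * |x - y|
  /-- the expanding map `f`, with `f (g i x) = x` -/
  f : ℝ → ℝ
  /-- the derivative `f'` of `f` on the ranges of the `g i` -/
  fder : ℝ → ℝ
  hf : ∀ i, ∀ x ∈ ⋃ j, Isub j, f (g i x) = x
  hfder : ∀ i, ∀ x ∈ ⋃ j, Isub j, fder (g i x) = (gder i x)⁻¹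
  /-- the generator (expansivity) condition: `d_n → 0` -/
  hgen : ∀ ε : ℝ, 0 < ε → ∃ N : ℕ, ∀ w : List (Fin p), N ≤ w.length →
    Metric.diam (cylOf I Isub g w) < ε
  /-- the finite set of forbidden words -/
  Q : Finset (List (Fin p))
  /-- `Σ_Q` is completely invariant: `σ(Σ_Q) = Σ_Q` -/
  hQinv : ∀ ω : ℕ → Fin p, avoids Q ω →
    ∃ ω' : ℕ → Fin p, avoids Q ω' ∧ ∀ n : ℕ, ω' (n + 1) = ω n
  /-- `f|Λ_Q` is topologically transitive -/
  htrans : ∀ U V : Set ℝ, IsOpen U → IsOpen V →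
    (U ∩ limitSetOf I Isub g Q).Nonempty → (V ∩ limitSetOf I Isub g Q).Nonempty →
    ∃ n : ℕ, ∃ x ∈ U ∩ limitSetOf I Isub g Q, f^[n] x ∈ V

namespace ExpansiveMarkovSystem

variable {p : ℕ} (S : ExpansiveMarkovSystem p)

/-- The common domain `⋃ j, I_j` of the maps `g i`. -/
def dom : Set ℝ := ⋃ j, S.Isub j

/-- The cylinder `Δ_w` associated to the word `w`. -/
def cyl (w : List (Fin p)) : Set ℝ := cylOf S.I S.Isub S.g w

/-- The limit set `Λ_Q`. -/
def limitSet : Set ℝ := limitSetOf S.I S.Isub S.g S.Q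

/-- The domain of `f`, i.e. the union of the ranges of the `g i`. -/
def domF : Set ℝ := ⋃ i, S.g i '' S.dom

/-- The derivative `(fⁿ)'(x)` of the `n`-th iterate of `f` at `x`. -/
noncomputable def derIter (n : ℕ) (x : ℝ) : ℝ :=
  ∏ k ∈ Finset.range n, S.fder (S.f^[k] x)

/-- The Lyapunov exponent `χ(x) = limsup (1/n) log |(fⁿ)'(x)|`. -/
noncomputable def lyap (x : ℝ) : ℝ :=
  Filter.limsup (fun n : ℕ => Real.log |S.derIter n x| / n) Filter.atTop

/-- The set `H` of points of `Λ_Q` with infinitely many hyperbolic instants. -/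
def hypSet : Set ℝ :=
  { x ∈ S.limitSet | ∃ c₁ : ℝ, 0 < c₁ ∧ ∃ c₂ : ℝ, 0 < c₂ ∧
      ∃ n : ℕ → ℕ, StrictMono n ∧
        ∃ r : ℕ → ℝ, (∀ k, 0 < r k) ∧ Antitone r ∧
          Filter.Tendsto r Filter.atTop (nhds 0) ∧
          ∀ k : ℕ,
            (∀ y ∈ Metric.ball x (r k), ∀ j < n k, S.f^[j] y ∈ S.domF) ∧
            c₁ < Metric.diam (S.f^[n k] '' Metric.ball x (r k)) ∧
            (∀ y ∈ Metric.ball x (r k), ∀ z ∈ Metric.ball x (r k),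
              |S.derIter (n k) y| / |S.derIter (n k) z| < c₂) }

/-- `x` is a parabolic periodic point: `f^m(x) = x` and `|(f^m)'(x)| = 1`. -/
def IsParabolicPeriodic (x : ℝ) : Prop :=
  x ∈ S.limitSet ∧ ∃ m : ℕ, 1 ≤ m ∧ S.f^[m] x = x ∧ |S.derIter m x| = 1

/-- `ν` is a `t`-conformal (Borel probability) measure supported on `Λ_Q`. -/
def IsConformal (ν : Measure ℝ) (t : ℝ) : Prop :=
  IsProbabilityMeasure ν ∧ ν S.limitSetᶜ = 0 ∧
    ∀ A : Set ℝ, MeasurableSet A → A ⊆ S.limitSet → Set.InjOn S.f A →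
      ν (S.f '' A) = ∫⁻ x in A, ENNReal.ofReal (|S.fder x| ^ t) ∂ν

/-- `t_c = inf {t ≥ 0 : a t-conformal measure on Λ_Q exists}`. -/
noncomputable def tc : ℝ :=
  sInf { t : ℝ | 0 ≤ t ∧ ∃ ν : Measure ℝ, S.IsConformal ν t }

/-- `n` is a hyperbolic time for `x` with exponent `α`. -/
def IsHypTime (α : ℝ) (x : ℝ) (n : ℕ) : Prop :=
  ∀ k : ℕ, 1 ≤ k → k ≤ n → Real.exp (k * α) ≤ |S.derIter k (S.f^[n - k] x)|

/-- `H_HT(α)`: the points of `Λ_Q` with infinitely many hyperbolic times with exponent `α`. -/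
def HHT (α : ℝ) : Set ℝ :=
  { x ∈ S.limitSet | ∀ N : ℕ, ∃ n : ℕ, N ≤ n ∧ S.IsHypTime α x n }

end ExpansiveMarkovSystem

namespace ExpansiveMarkovSystem

section

variable {p : ℕ} (S : ExpansiveMarkovSystem p)

theorem isub_subset_dom (i : Fin p) : S.Isub i ⊆ S.dom :=
  subset_iUnion S.Isub i

theorem ordConnected_isub (i : Fin p) : (S.Isub i).OrdConnected := by
  obtain ⟨a, b, -, h⟩ := S.hIsub i
  rw [h]; exact ordConnected_Icc

theorem isCompact_isub (i : Fin p) : IsCompact (S.Isub i) := by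
  obtain ⟨a, b, -, h⟩ := S.hIsub i
  rw [h]; exact isCompact_Icc

theorem isCompact_dom : IsCompact S.dom := isCompact_iUnion S.isCompact_isub

theorem eq_of_mem_isub {i j : Fin p} {u : ℝ} (hi : u ∈ S.Isub i) (hj : u ∈ S.Isub j) : i = j := by
  by_contra h
  exact Set.disjoint_left.1 (S.hdisj i j h) hi hj

theorem g_mem_interior (i : Fin p) {u : ℝ} (hu : u ∈ S.dom) : S.g i u ∈ interior (S.Isub i) :=
  S.hg_range i (mem_image_of_mem _ hu)

theorem g_mem_isub (i : Fin p) {u : ℝ} (hu : u ∈ S.dom) : S.g i u ∈ S.Isub i :=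
  interior_subset (S.g_mem_interior i hu)

theorem continuousOn_g (i : Fin p) : ContinuousOn (S.g i) S.dom := fun x hx =>
  (S.hg_deriv i x hx).continuousWithinAt

theorem domF_subset_dom : S.domF ⊆ S.dom := by
  intro x hx
  obtain ⟨i, u, hu, rfl⟩ := mem_iUnion.1 hx
  exact S.isub_subset_dom i (S.g_mem_isub i hu)

theorem isCompact_domF : IsCompact S.domF :=
  isCompact_iUnion fun i => S.isCompact_dom.image_of_continuousOn (S.continuousOn_g i)

theorem g_mem_domF (i : Fin p) {u : ℝ} (hu : u ∈ S.dom) : S.g i u ∈ S.domF :=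
  mem_iUnion.2 ⟨i, u, hu, rfl⟩

theorem f_mem_dom {x : ℝ} (hx : x ∈ S.domF) : S.f x ∈ S.dom := by
  obtain ⟨i, u, hu, rfl⟩ := mem_iUnion.1 hx
  rwa [S.hf i u hu]

theorem exists_index {x : ℝ} (hx : x ∈ S.domF) :
    ∃ i, x ∈ interior (S.Isub i) ∧ S.g i (S.f x) = x := by
  obtain ⟨i, u, hu, rfl⟩ := mem_iUnion.1 hx
  exact ⟨i, S.g_mem_interior i hu, by rw [S.hf i u hu]⟩

theorem g_f_of_mem_isub {x : ℝ} {i : Fin p} (hx : x ∈ S.domF) (hi : x ∈ S.Isub i) :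
    S.g i (S.f x) = x := by
  obtain ⟨j, hj, h⟩ := S.exists_index hx
  rwa [S.eq_of_mem_isub hi (interior_subset hj)]

theorem continuousOn_f : ContinuousOn S.f S.domF := by
  rw [continuousOn_iff_isClosed]
  intro t ht
  refine ⟨⋃ i, S.g i '' (S.dom ∩ t), IsCompact.isClosed (isCompact_iUnion fun i =>
    (S.isCompact_dom.inter_right ht).image_of_continuousOn
      ((S.continuousOn_g i).mono inter_subset_left)), ?_⟩
  ext x
  constructor
  · rintro ⟨hxt, hx⟩
    obtain ⟨i, -, hgx⟩ := S.exists_index hx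
    exact ⟨mem_iUnion.2 ⟨i, S.f x, ⟨S.f_mem_dom hx, hxt⟩, hgx⟩, hx⟩
  · rintro ⟨hxu, hx⟩
    obtain ⟨i, u, ⟨hu, hut⟩, rfl⟩ := mem_iUnion.1 hxu
    refine ⟨?_, hx⟩
    rw [mem_preimage, S.hf i u hu]
    exact hut

theorem fder_ne_zero {x : ℝ} (hx : x ∈ S.domF) : S.fder x ≠ 0 := by
  obtain ⟨i, u, hu, rfl⟩ := mem_iUnion.1 hx
  rw [S.hfder i u hu]
  exact inv_ne_zero (S.hgder_ne i u hu)

theorem hasDerivWithinAt_f {x : ℝ} (hx : x ∈ S.domF) :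
    HasDerivWithinAt S.f (S.fder x) S.domF x := by
  obtain ⟨i, hi, hgx⟩ := S.exists_index hx
  have hnhds : S.Isub i ∈ nhds x := mem_interior_iff_mem_nhds.1 hi
  have hfx := S.f_mem_dom hx
  have hder : S.fder x = (S.gder i (S.f x))⁻¹ := by
    rw [← S.hfder i _ hfx, hgx]
  have hne := S.hgder_ne i _ hfx
  have hF : HasFDerivWithinAt (S.g i) (ContinuousLinearEquiv.unitsEquivAut ℝ
      (Units.mk0 (S.gder i (S.f x)) hne) : ℝ →L[ℝ] ℝ) S.dom (S.f x) :=
    S.hg_deriv i _ hfx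
  have htend : Tendsto S.f (nhdsWithin x S.domF) (nhdsWithin (S.f x) S.dom) :=
    (S.continuousOn_f x hx).tendsto_nhdsWithin fun y hy => S.f_mem_dom hy
  have := hF.of_local_left_inverse htend hx (by
    filter_upwards [self_mem_nhdsWithin, mem_nhdsWithin_of_mem_nhds hnhds] with y hy hyi
    exact S.g_f_of_mem_isub hy hyi)
  rw [hder]
  exact this

/-! ### Compositions of inverse branches -/

theorem gIter_mem_dom (α : ℕ → Fin p) (k : ℕ) {u : ℝ} (hu : u ∈ S.dom) :
    gIter S.g α k u ∈ S.dom := by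
  induction k with
  | zero => exact hu
  | succ k ih => exact S.isub_subset_dom _ (S.g_mem_isub (α k) ih)

theorem gIter_succ_mem_isub (α : ℕ → Fin p) (k : ℕ) {u : ℝ} (hu : u ∈ S.dom) :
    gIter S.g α (k + 1) u ∈ S.Isub (α k) :=
  S.g_mem_isub (α k) (S.gIter_mem_dom α k hu)

theorem exists_gIter_mem_isub (α : ℕ → Fin p) (k : ℕ) (j : Fin p) :
    ∃ i, ∀ u ∈ S.Isub j, gIter S.g α k u ∈ S.Isub i := by
  cases k with
  | zero => exact ⟨j, fun u hu => hu⟩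
  | succ k => exact ⟨α k, fun u hu => S.gIter_succ_mem_isub α k (S.isub_subset_dom j hu)⟩

theorem gIter_succ_mem_domF (α : ℕ → Fin p) (k : ℕ) {u : ℝ} (hu : u ∈ S.dom) :
    gIter S.g α (k + 1) u ∈ S.domF :=
  S.g_mem_domF (α k) (S.gIter_mem_dom α k hu)

theorem iterate_f_gIter (α : ℕ → Fin p) {n k : ℕ} (hk : k ≤ n) {u : ℝ} (hu : u ∈ S.dom) :
    S.f^[k] (gIter S.g α n u) = gIter S.g α (n - k) u := by
  induction k generalizing n with
  | zero => rfl
  | succ k ih =>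
    obtain ⟨n, rfl⟩ : ∃ m, n = m + 1 := ⟨n - 1, by omega⟩
    rw [Function.iterate_succ_apply]
    have : S.f (gIter S.g α (n + 1) u) = gIter S.g α n u :=
      S.hf (α n) _ (S.gIter_mem_dom α n hu)
    rw [this, ih (by omega)]
    congr 1
    omega

theorem iterate_f_gIter_self (α : ℕ → Fin p) (n : ℕ) {u : ℝ} (hu : u ∈ S.dom) :
    S.f^[n] (gIter S.g α n u) = u := by
  rw [S.iterate_f_gIter α le_rfl hu, Nat.sub_self]
  rfl

theorem gIter_add (g : Fin p → ℝ → ℝ) (α : ℕ → Fin p) (h k : ℕ) (u : ℝ) :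
    gIter g α (h + k) u = gIter g (fun i => α (h + i)) k (gIter g α h u) := by
  induction k with
  | zero => rfl
  | succ k ih =>
    change g (α (h + k)) (gIter g α (h + k) u) = _
    rw [ih]
    rfl

theorem gIter_congr (g : Fin p → ℝ → ℝ) {α β : ℕ → Fin p} {k : ℕ} (h : ∀ i < k, α i = β i)
    (u : ℝ) : gIter g α k u = gIter g β k u := by
  induction k with
  | zero => rfl
  | succ k ih =>
    change g (α k) (gIter g α k u) = g (β k) (gIter g β k u)
    rw [ih fun i hi => h i (by omega), h k (by omega)]

theorem injOn_gIter (α : ℕ → Fin p) (k : ℕ) : InjOn (gIter S.g α k) S.dom := by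
  intro u hu v hv h
  rw [← S.iterate_f_gIter_self α k hu, ← S.iterate_f_gIter_self α k hv, h]

theorem hasDerivWithinAt_gIter (α : ℕ → Fin p) (k : ℕ) {u : ℝ} (hu : u ∈ S.dom) :
    HasDerivWithinAt (gIter S.g α k) (gIterDer S.g S.gder α k u) S.dom u := by
  induction k with
  | zero => simpa [gIterDer, gIter] using hasDerivWithinAt_id u S.dom
  | succ k ih =>
    have := (S.hg_deriv (α k) _ (S.gIter_mem_dom α k hu)).comp u ih
      fun v hv => S.gIter_mem_dom α k hv
    rw [gIterDer, Finset.prod_range_succ, mul_comm]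
    exact this

theorem gIterDer_ne_zero (α : ℕ → Fin p) (k : ℕ) {u : ℝ} (hu : u ∈ S.dom) :
    gIterDer S.g S.gder α k u ≠ 0 :=
  Finset.prod_ne_zero_iff.2 fun i _ => S.hgder_ne _ _ (S.gIter_mem_dom α i hu)

theorem derIter_gIter (α : ℕ → Fin p) (n : ℕ) {u : ℝ} (hu : u ∈ S.dom) :
    S.derIter n (gIter S.g α n u) = (gIterDer S.g S.gder α n u)⁻¹ := by
  rw [derIter, gIterDer, ← Finset.prod_range_reflect, ← Finset.prod_inv_distrib]
  refine Finset.prod_congr rfl fun k hk => ?_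
  have hk := Finset.mem_range.1 hk
  rw [S.iterate_f_gIter α (by omega) hu, show n - (n - 1 - k) = k + 1 by omega]
  exact S.hfder (α k) _ (S.gIter_mem_dom α k hu)

theorem continuousOn_gIter (α : ℕ → Fin p) (k : ℕ) : ContinuousOn (gIter S.g α k) S.dom :=
  fun _ hu => (S.hasDerivWithinAt_gIter α k hu).continuousWithinAt

/-- The distance between the images of `u` and `v` under `k` inverse branches. -/
def spread (α : ℕ → Fin p) (k : ℕ) (u v : ℝ) : ℝ := |gIter S.g α k u - gIter S.g α k v|

theorem spread_nonneg (α : ℕ → Fin p) (k : ℕ) (u v : ℝ) : 0 ≤ S.spread α k u v := abs_nonneg _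

theorem strictMonoOn_or_strictAntiOn_gIter (α : ℕ → Fin p) (k : ℕ) {a b : ℝ} {j : Fin p}
    (hab : a ≤ b) (hj : Icc a b ⊆ S.Isub j) :
    StrictMonoOn (gIter S.g α k) (Icc a b) ∨ StrictAntiOn (gIter S.g α k) (Icc a b) :=
  have hd := hj.trans (S.isub_subset_dom j)
  ((S.continuousOn_gIter α k).mono hd).strictMonoOn_of_injOn_Icc' hab
    ((S.injOn_gIter α k).mono hd)

theorem spread_le_spread (α : ℕ → Fin p) (k : ℕ) {a b u v : ℝ} {j : Fin p}
    (hj : Icc a b ⊆ S.Isub j) (hu : u ∈ Icc a b) (hv : v ∈ Icc a b) :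
    S.spread α k u v ≤ S.spread α k a b := by
  have hab := hu.1.trans hu.2
  have ha : a ∈ Icc a b := left_mem_Icc.2 hab
  have hb : b ∈ Icc a b := right_mem_Icc.2 hab
  unfold spread
  rcases S.strictMonoOn_or_strictAntiOn_gIter α k hab hj with h | h
  · have h1 := h.monotoneOn ha hu hu.1
    have h2 := h.monotoneOn hu hb hu.2
    have h3 := h.monotoneOn ha hv hv.1
    have h4 := h.monotoneOn hv hb hv.2
    rw [abs_sub_comm (gIter S.g α k a), abs_of_nonneg (by linarith : 0 ≤ gIter S.g α k b - _)]
    exact abs_le.2 ⟨by linarith, by linarith⟩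
  · have h1 := h.antitoneOn ha hu hu.1
    have h2 := h.antitoneOn hu hb hu.2
    have h3 := h.antitoneOn ha hv hv.1
    have h4 := h.antitoneOn hv hb hv.2
    rw [abs_of_nonneg (by linarith : 0 ≤ gIter S.g α k a - _)]
    exact abs_le.2 ⟨by linarith, by linarith⟩

theorem spread_add (α : ℕ → Fin p) (h k : ℕ) (u v : ℝ) : S.spread α (h + k) u v =
    S.spread (fun i => α (h + i)) k (gIter S.g α h u) (gIter S.g α h v) := by
  simp only [spread, gIter_add]

/-! ### Uniform contraction -/

theorem exists_word_image_eq (α : ℕ → Fin p) (k : ℕ) (j : Fin p) :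
    ∃ w : List (Fin p), w.length = k + 1 ∧
      gIter S.g α k '' S.Isub j = cylOf S.I S.Isub S.g w := by
  induction k with
  | zero => exact ⟨[j], rfl, by simp [gIter, cylOf]⟩
  | succ k ih =>
    obtain ⟨w, hw, h⟩ := ih
    obtain ⟨i, w, rfl⟩ : ∃ i w', w = i :: w' := by
      cases w with
      | nil => simp at hw
      | cons i w => exact ⟨i, w, rfl⟩
    refine ⟨α k :: i :: w, by simp at hw ⊢; omega, ?_⟩
    change (S.g (α k) ∘ gIter S.g α k) '' _ = S.g (α k) '' _
    rw [image_comp, h]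

theorem exists_spread_lt {ε : ℝ} (hε : 0 < ε) : ∃ N, ∀ (α : ℕ → Fin p) (k : ℕ), N ≤ k →
    ∀ (j : Fin p), ∀ u ∈ S.Isub j, ∀ v ∈ S.Isub j, S.spread α k u v < ε := by
  obtain ⟨N, hN⟩ := S.hgen ε hε
  refine ⟨N, fun α k hk j u hu v hv => ?_⟩
  obtain ⟨w, hw, h⟩ := S.exists_word_image_eq α k j
  have hd := hN w (by omega)
  rw [← h] at hd
  have hc : IsCompact (gIter S.g α k '' S.Isub j) := (S.isCompact_isub j).image_of_continuousOn
    ((S.continuousOn_gIter α k).mono (S.isub_subset_dom j))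
  exact (Metric.dist_le_diam_of_mem hc.isBounded (mem_image_of_mem _ hu)
    (mem_image_of_mem _ hv)).trans_lt hd

theorem exists_lipschitz : ∃ M : ℝ, 1 ≤ M ∧ ∀ (i j : Fin p), ∀ u ∈ S.Isub j, ∀ v ∈ S.Isub j,
    |S.g i u - S.g i v| ≤ M * |u - v| := by
  have h1 : ∀ i, ∃ M, ∀ x ∈ S.dom, ‖S.gder i x‖ ≤ M := fun i =>
    S.isCompact_dom.exists_bound_of_continuousOn (S.hgder_cont i)
  choose M hM using h1
  refine ⟨1 + ∑ i, |M i|, ?_, fun i j u hu v hv => ?_⟩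
  · have : 0 ≤ ∑ i, |M i| := Finset.sum_nonneg fun _ _ => abs_nonneg _
    linarith
  · have hconv : Convex ℝ (S.Isub j) := (S.ordConnected_isub j).convex
    have hle : M i ≤ 1 + ∑ i, |M i| := by
      have := Finset.single_le_sum (f := fun i => |M i|) (fun _ _ => abs_nonneg _)
        (Finset.mem_univ i)
      have := le_abs_self (M i)
      linarith
    exact hconv.norm_image_sub_le_of_norm_hasDerivWithin_le
      (fun x hx => (S.hg_deriv i x (S.isub_subset_dom j hx)).mono (S.isub_subset_dom j))
      (fun x hx => (hM i x (S.isub_subset_dom j hx)).trans hle) hv hu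

theorem spread_le_pow {M : ℝ} (hM1 : 1 ≤ M) (hM : ∀ (i j : Fin p), ∀ u ∈ S.Isub j,
    ∀ v ∈ S.Isub j, |S.g i u - S.g i v| ≤ M * |u - v|) (α : ℕ → Fin p) (k : ℕ) {j : Fin p}
    {u v : ℝ} (hu : u ∈ S.Isub j) (hv : v ∈ S.Isub j) :
    S.spread α k u v ≤ M ^ k * |u - v| := by
  induction k with
  | zero => simp [spread, gIter]
  | succ k ih =>
    obtain ⟨i, hi⟩ := S.exists_gIter_mem_isub α k j
    calc S.spread α (k + 1) u v ≤ M * S.spread α k u v := hM (α k) i _ (hi u hu) _ (hi v hv)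
      _ ≤ M * (M ^ k * |u - v|) := by gcongr
      _ = M ^ (k + 1) * |u - v| := by ring

theorem exists_equicontinuous {ε : ℝ} (hε : 0 < ε) : ∃ δ > 0, ∀ (α : ℕ → Fin p) (k : ℕ)
    (j : Fin p), ∀ u ∈ S.Isub j, ∀ v ∈ S.Isub j, |u - v| ≤ δ → S.spread α k u v < ε := by
  obtain ⟨N, hN⟩ := S.exists_spread_lt hε
  obtain ⟨M, hM1, hM⟩ := S.exists_lipschitz
  have hMN : 0 < M ^ N := by positivity
  refine ⟨ε / (2 * M ^ N), by positivity, fun α k j u hu v hv huv => ?_⟩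
  rcases le_or_gt N k with h | h
  · exact hN α k h j u hu v hv
  · calc S.spread α k u v ≤ M ^ k * |u - v| := S.spread_le_pow hM1 hM α k hu hv
      _ ≤ M ^ N * (ε / (2 * M ^ N)) := by gcongr
      _ = ε / 2 := by field_simp
      _ < ε := by linarith

end

section

variable {p : ℕ} (S : ExpansiveMarkovSystem p)

/-! ### Bounded distortion -/

/-- `Θ` is a common Lipschitz constant of the functions `log |g i'|`. -/
def IsDistortionConst (Θ : ℝ) : Prop :=
  0 ≤ Θ ∧ ∀ i, ∀ x ∈ S.dom, ∀ y ∈ S.dom,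
    abs (Real.log |S.gder i x| - Real.log |S.gder i y|) ≤ Θ * |x - y|

theorem exists_isDistortionConst : ∃ Θ, S.IsDistortionConst Θ := by
  choose θ hθ using S.hgder_lip
  refine ⟨∑ i, |θ i|, Finset.sum_nonneg fun _ _ => abs_nonneg _, fun i x hx y hy => ?_⟩
  refine (hθ i x hx y hy).trans (mul_le_mul_of_nonneg_right ?_ (abs_nonneg _))
  exact (le_abs_self _).trans
    (Finset.single_le_sum (f := fun i => |θ i|) (fun _ _ => abs_nonneg _) (Finset.mem_univ i))

theorem log_abs_gIterDer (α : ℕ → Fin p) (k : ℕ) {u : ℝ} (hu : u ∈ S.dom) :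
    Real.log |gIterDer S.g S.gder α k u| =
      ∑ i ∈ Finset.range k, Real.log |S.gder (α i) (gIter S.g α i u)| := by
  rw [gIterDer, Finset.abs_prod, Real.log_prod]
  exact fun i _ => abs_ne_zero.2 (S.hgder_ne _ _ (S.gIter_mem_dom α i hu))

variable {S} {Θ : ℝ}

theorem IsDistortionConst.abs_gIterDer_le (hΘ : S.IsDistortionConst Θ) {α : ℕ → Fin p} {k : ℕ}
    {a b K : ℝ} {j : Fin p} (hj : Icc a b ⊆ S.Isub j)
    (hK : ∑ i ∈ Finset.range k, S.spread α i a b ≤ K) {u v : ℝ}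
    (hu : u ∈ Icc a b) (hv : v ∈ Icc a b) :
    |gIterDer S.g S.gder α k u| ≤ Real.exp (Θ * K) * |gIterDer S.g S.gder α k v| := by
  have hud := S.isub_subset_dom j (hj hu)
  have hvd := S.isub_subset_dom j (hj hv)
  have hup := abs_pos.2 (S.gIterDer_ne_zero α k hud)
  have hvp := abs_pos.2 (S.gIterDer_ne_zero α k hvd)
  have hlog : Real.log |gIterDer S.g S.gder α k u| - Real.log |gIterDer S.g S.gder α k v|
      ≤ Θ * K := by
    rw [S.log_abs_gIterDer α k hud, S.log_abs_gIterDer α k hvd, ← Finset.sum_sub_distrib]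
    calc _ ≤ ∑ i ∈ Finset.range k, Θ * S.spread α i a b := by
          refine Finset.sum_le_sum fun i _ => ?_
          refine (le_abs_self _).trans ((hΘ.2 _ _ (S.gIter_mem_dom α i hud) _
            (S.gIter_mem_dom α i hvd)).trans ?_)
          exact mul_le_mul_of_nonneg_left (S.spread_le_spread α i hj hu hv) hΘ.1
      _ = Θ * ∑ i ∈ Finset.range k, S.spread α i a b := (Finset.mul_sum ..).symm
      _ ≤ Θ * K := mul_le_mul_of_nonneg_left hK hΘ.1
  rw [← Real.log_le_log_iff hup (by positivity), Real.log_mul (Real.exp_pos _).ne' hvp.ne',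
    Real.log_exp]
  linarith

theorem exists_spread_eq (α : ℕ → Fin p) (k : ℕ) {a b u v : ℝ} {j : Fin p}
    (hj : Icc a b ⊆ S.Isub j) (hu : u ∈ Icc a b) (hv : v ∈ Icc a b) :
    ∃ ξ ∈ Icc a b, S.spread α k u v = |gIterDer S.g S.gder α k ξ| * |u - v| := by
  wlog huv : u ≤ v generalizing u v
  · obtain ⟨ξ, hξ, h⟩ := this hv hu (le_of_not_ge huv)
    exact ⟨ξ, hξ, by rw [abs_sub_comm u v, ← h, spread, spread, abs_sub_comm]⟩
  rcases huv.eq_or_lt with rfl | huv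
  · exact ⟨u, hu, by simp [spread]⟩
  have hsub : Icc u v ⊆ Icc a b := Icc_subset_Icc hu.1 hv.2
  have hd := (hsub.trans hj).trans (S.isub_subset_dom j)
  obtain ⟨ξ, hξ, h⟩ := exists_hasDerivAt_eq_slope (gIter S.g α k) (gIterDer S.g S.gder α k) huv
    ((S.continuousOn_gIter α k).mono hd) fun x hx =>
      (S.hasDerivWithinAt_gIter α k (hd (Ioo_subset_Icc_self hx))).hasDerivAt
        (mem_of_superset (Icc_mem_nhds hx.1 hx.2) hd)
  refine ⟨ξ, hsub (Ioo_subset_Icc_self hξ), ?_⟩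
  have hne : v - u ≠ 0 := sub_ne_zero.2 huv.ne'
  rw [h, abs_div, spread, abs_sub_comm u v, div_mul_cancel₀ _ (abs_ne_zero.2 hne), abs_sub_comm]

theorem IsDistortionConst.spread_mul_le (hΘ : S.IsDistortionConst Θ) {α : ℕ → Fin p} {k : ℕ}
    {a b K : ℝ} {j : Fin p} (hj : Icc a b ⊆ S.Isub j)
    (hK : ∑ i ∈ Finset.range k, S.spread α i a b ≤ K) {u v s t : ℝ}
    (hu : u ∈ Icc a b) (hv : v ∈ Icc a b) (hs : s ∈ Icc a b) (ht : t ∈ Icc a b) :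
    S.spread α k u v * |s - t| ≤ Real.exp (Θ * K) * S.spread α k s t * |u - v| := by
  obtain ⟨ξ, hξ, h1⟩ := exists_spread_eq α k hj hu hv
  obtain ⟨ζ, hζ, h2⟩ := exists_spread_eq α k hj hs ht
  rw [h1, h2]
  have := mul_le_mul_of_nonneg_right (hΘ.abs_gIterDer_le hj hK hξ hζ)
    (mul_nonneg (abs_nonneg (u - v)) (abs_nonneg (s - t)))
  linarith

theorem spread_triangle (α : ℕ → Fin p) (k : ℕ) (u v w : ℝ) :
    S.spread α k u w ≤ S.spread α k u v + S.spread α k v w := abs_sub_le _ _ _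

/-- If the images of `[a, b]` have bounded total length, then so have the images of a slightly
larger interval. -/
theorem IsDistortionConst.spread_collar_le (hΘ : S.IsDistortionConst Θ) {α : ℕ → Fin p} {k : ℕ}
    {a b a' b' K : ℝ} {j : Fin p} (hab : a < b) (ha : a' ≤ a) (hb : b ≤ b')
    (hj : Icc a' b' ⊆ S.Isub j) (hK : ∑ i ∈ Finset.range k, S.spread α i a b ≤ K)
    (haC : Real.exp (Θ * (3 * K)) * (a - a') ≤ b - a)
    (hbC : Real.exp (Θ * (3 * K)) * (b' - b) ≤ b - a) :
    ∀ i ≤ k, S.spread α i a' b' ≤ 3 * S.spread α i a b := by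
  intro i
  induction i using Nat.strong_induction_on with
  | _ i ih =>
    intro hik
    have hsum : ∑ l ∈ Finset.range i, S.spread α l a' b' ≤ 3 * K := by
      calc _ ≤ ∑ l ∈ Finset.range i, 3 * S.spread α l a b := by
            refine Finset.sum_le_sum fun l hl => ?_
            have := Finset.mem_range.1 hl
            exact ih l this (by omega)
        _ = 3 * ∑ l ∈ Finset.range i, S.spread α l a b := (Finset.mul_sum ..).symm
        _ ≤ 3 * ∑ l ∈ Finset.range k, S.spread α l a b := by
            refine mul_le_mul_of_nonneg_left ?_ (by norm_num)
            exact Finset.sum_le_sum_of_subset_of_nonneg (Finset.range_mono hik)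
              fun l _ _ => S.spread_nonneg α l a b
        _ ≤ 3 * K := by linarith
    have hma' : a' ∈ Icc a' b' := ⟨le_rfl, by linarith⟩
    have hma : a ∈ Icc a' b' := ⟨ha, by linarith⟩
    have hmb : b ∈ Icc a' b' := ⟨by linarith, hb⟩
    have hmb' : b' ∈ Icc a' b' := ⟨by linarith, le_rfl⟩
    have h1 := hΘ.spread_mul_le hj hsum hma' hma hma hmb
    have h2 := hΘ.spread_mul_le hj hsum hmb hmb' hma hmb
    have hpos : 0 < b - a := by linarith
    have hnn := S.spread_nonneg α i a b
    rw [abs_sub_comm a b, abs_of_pos hpos] at h1 h2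
    rw [abs_sub_comm, abs_of_nonneg (by linarith : 0 ≤ a - a')] at h1
    rw [abs_sub_comm b b', abs_of_nonneg (by linarith : 0 ≤ b' - b)] at h2
    have h1' : S.spread α i a' a ≤ S.spread α i a b := by
      refine le_of_mul_le_mul_right (h1.trans ?_) hpos
      nlinarith [mul_le_mul_of_nonneg_left haC hnn]
    have h2' : S.spread α i b b' ≤ S.spread α i a b := by
      refine le_of_mul_le_mul_right (h2.trans ?_) hpos
      nlinarith [mul_le_mul_of_nonneg_left hbC hnn]
    have := spread_triangle (S := S) α i a' a b'
    have := spread_triangle (S := S) α i a b b'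
    linarith

/-! ### Disjoint images -/

variable (S)

/-- The length of the ambient interval. -/
noncomputable def len : ℝ := (volume S.I).toReal

theorem volume_I_ne_top : volume S.I ≠ ⊤ := by
  obtain ⟨a, b, -, h⟩ := S.hI
  rw [h, Real.volume_Icc]
  exact ENNReal.ofReal_ne_top

theorem len_pos : 0 < S.len := by
  obtain ⟨a, b, hab, h⟩ := S.hI
  rw [len, h, Real.volume_Icc, ENNReal.toReal_ofReal (by linarith)]
  linarith

theorem dom_subset_I : S.dom ⊆ S.I := iUnion_subset S.hsubI

theorem Ioo_subset_image_gIter (α : ℕ → Fin p) (k : ℕ) {a b : ℝ} {j : Fin p}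
    (hab : a ≤ b) (hj : Icc a b ⊆ S.Isub j) :
    Ioo (min (gIter S.g α k a) (gIter S.g α k b)) (max (gIter S.g α k a) (gIter S.g α k b)) ⊆
      gIter S.g α k '' Ioo a b := by
  have hc := (S.continuousOn_gIter α k).mono (hj.trans (S.isub_subset_dom j))
  rcases le_total (gIter S.g α k a) (gIter S.g α k b) with h | h
  · rw [min_eq_left h, max_eq_right h]
    exact intermediate_value_Ioo hab hc
  · rw [min_eq_right h, max_eq_left h]
    exact intermediate_value_Ioo' hab hc

theorem sum_spread_le_of_pairwiseDisjoint (α : ℕ → Fin p) {a b : ℝ} {j : Fin p}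
    (hab : a ≤ b) (hj : Icc a b ⊆ S.Isub j) (s : Finset ℕ)
    (hs : (s : Set ℕ).PairwiseDisjoint fun k => gIter S.g α k '' Ioo a b) :
    ∑ k ∈ s, S.spread α k a b ≤ S.len := by
  set U : ℕ → Set ℝ := fun k => Ioo (min (gIter S.g α k a) (gIter S.g α k b))
    (max (gIter S.g α k a) (gIter S.g α k b)) with hU
  have hUs : ∀ k, U k ⊆ gIter S.g α k '' Ioo a b := fun k =>
    S.Ioo_subset_image_gIter α k hab hj
  have hdisj : (s : Set ℕ).PairwiseDisjoint U := hs.mono_on fun k _ => hUs k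
  have hvol : ∀ k, volume (U k) = ENNReal.ofReal (S.spread α k a b) := fun k => by
    rw [hU, Real.volume_Ioo, max_sub_min_eq_abs, spread, abs_sub_comm]
  have hsub : (⋃ k ∈ s, U k) ⊆ S.I := by
    refine iUnion₂_subset fun k _ => (hUs k).trans ?_
    rintro _ ⟨u, hu, rfl⟩
    exact S.dom_subset_I (S.gIter_mem_dom α k
      (S.isub_subset_dom j (hj (Ioo_subset_Icc_self hu))))
  have hle := measure_mono (μ := volume) hsub
  rw [measure_biUnion_finset hdisj fun k _ => measurableSet_Ioo] at hle
  simp only [hvol] at hle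
  rw [← ENNReal.ofReal_sum_of_nonneg fun k _ => S.spread_nonneg α k a b] at hle
  exact (ENNReal.ofReal_le_iff_le_toReal S.volume_I_ne_top).1 hle

theorem spread_le_len (α : ℕ → Fin p) (k : ℕ) {a b : ℝ} {j : Fin p}
    (hab : a ≤ b) (hj : Icc a b ⊆ S.Isub j) : S.spread α k a b ≤ S.len := by
  simpa using S.sum_spread_le_of_pairwiseDisjoint α hab hj {k} (by simp)

theorem sum_spread_le_of_no_return (α : ℕ → Fin p) {a b : ℝ} {j : Fin p} {n : ℕ}
    (hab : a ≤ b) (hj : Icc a b ⊆ S.Isub j)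
    (hret : ∀ h, 1 ≤ h → h < n → Disjoint (gIter S.g α h '' Ioo a b) (Ioo a b)) :
    ∑ k ∈ Finset.range n, S.spread α k a b ≤ S.len := by
  refine S.sum_spread_le_of_pairwiseDisjoint α hab hj _ ?_
  have hd : Ioo a b ⊆ S.dom := Ioo_subset_Icc_self.trans (hj.trans (S.isub_subset_dom j))
  have key : ∀ k l, k < l → l < n →
      Disjoint (gIter S.g α k '' Ioo a b) (gIter S.g α l '' Ioo a b) := by
    intro k l hkl hln
    rw [Set.disjoint_left]
    rintro _ ⟨u, hu, rfl⟩ ⟨v, hv, huv⟩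
    have h1 : gIter S.g α (l - k) v = u := by
      rw [← S.iterate_f_gIter α hkl.le (hd hv), huv, S.iterate_f_gIter_self α k (hd hu)]
    exact Set.disjoint_left.1 (hret (l - k) (by omega) (by omega)) ⟨v, hv, h1⟩ hu
  intro k hk l hl hkl
  have hk := Finset.mem_range.1 hk
  have hl := Finset.mem_range.1 hl
  rcases lt_or_gt_of_ne hkl with h | h
  · exact key k l h hl
  · exact (key l k h hk).symm

end

section

variable {p : ℕ} (S : ExpansiveMarkovSystem p)

/-! ### Coding of orbits -/

/-- The orbit of `x` stays in the domain of `f` and has itinerary `ω`. -/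
def IsCode (ω : ℕ → Fin p) (x : ℝ) : Prop :=
  ∀ n, S.f^[n] x ∈ S.domF ∧ S.f^[n] x ∈ S.Isub (ω n)

theorem wordOf_succ (ω : ℕ → Fin p) (n : ℕ) :
    wordOf ω (n + 1) = ω 0 :: wordOf (fun i => ω (i + 1)) n := by
  simp [wordOf, List.range_succ_eq_map, Function.comp_def]

theorem cylOf_subset_isub (i : Fin p) (w : List (Fin p)) :
    cylOf S.I S.Isub S.g (i :: w) ⊆ S.Isub i := by
  induction w generalizing i with
  | nil => exact subset_rfl
  | cons j w ih =>
    rintro _ ⟨u, hu, rfl⟩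
    exact S.g_mem_isub i (S.isub_subset_dom j (ih j hu))

theorem f_mem_limitSet {ω : ℕ → Fin p} {x : ℝ} (hω : avoids S.Q ω)
    (hx : ∀ n, x ∈ cylOf S.I S.Isub S.g (wordOf ω n)) :
    x ∈ S.domF ∧ x ∈ S.Isub (ω 0) ∧ avoids S.Q (fun i => ω (i + 1)) ∧
      ∀ n, S.f x ∈ cylOf S.I S.Isub S.g (wordOf (fun i => ω (i + 1)) n) := by
  have key : ∀ n, x ∈ S.domF ∧
      S.f x ∈ cylOf S.I S.Isub S.g (wordOf (fun i => ω (i + 1)) (n + 1)) := by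
    intro n
    have h := hx (n + 2)
    rw [wordOf_succ, wordOf_succ] at h
    obtain ⟨u, hu, rfl⟩ := h
    have hud := S.isub_subset_dom _ (S.cylOf_subset_isub _ _ hu)
    refine ⟨S.g_mem_domF _ hud, ?_⟩
    rw [S.hf _ u hud, wordOf_succ]
    exact hu
  refine ⟨(key 0).1, ?_, fun w hw n hc => hω w hw (n + 1) fun k hk => ?_, fun n => ?_⟩
  · have h := hx 1
    rw [wordOf_succ] at h
    exact S.cylOf_subset_isub _ _ h
  · rw [← hc k hk]
    exact congrArg ω (by omega)
  · cases n with
    | zero =>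
      have h := (key 0).2
      rw [wordOf_succ] at h
      exact S.hsubI _ (S.cylOf_subset_isub _ _ h)
    | succ n => exact (key n).2

theorem exists_isCode {x : ℝ} (hx : x ∈ S.limitSet) :
    (∃ ω, S.IsCode ω x) ∧ ∀ n, S.f^[n] x ∈ S.limitSet := by
  obtain ⟨ω, hω, h⟩ := hx
  have key : ∀ n, avoids S.Q (fun i => ω (i + n)) ∧
      ∀ k, S.f^[n] x ∈ cylOf S.I S.Isub S.g (wordOf (fun i => ω (i + n)) k) := by
    intro n
    induction n with
    | zero => exact ⟨hω, h⟩
    | succ n ih =>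
      obtain ⟨-, -, h1, h2⟩ := S.f_mem_limitSet ih.1 ih.2
      have : (fun i => ω (i + 1 + n)) = fun i => ω (i + (n + 1)) := by
        funext i; exact congrArg ω (by omega)
      rw [this] at h1 h2
      rw [Function.iterate_succ_apply']
      exact ⟨h1, h2⟩
  refine ⟨⟨ω, fun n => ?_⟩, fun n => ⟨_, (key n).1, (key n).2⟩⟩
  obtain ⟨h1, h2, -⟩ := S.f_mem_limitSet (key n).1 (key n).2
  refine ⟨h1, ?_⟩
  simpa using h2

/-- The reversed word `ω (m-1), …, ω 0`, which codes the inverse branch following the orbit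
from time `m` back to time `0`. -/
def past (ω : ℕ → Fin p) (m : ℕ) : ℕ → Fin p := fun i => ω (m - 1 - i)

theorem past_add (ω : ℕ → Fin p) (m h : ℕ) :
    (fun i => past ω m (h + i)) = past ω (m - h) := by
  funext i; exact congrArg ω (by omega)

variable {S} {ω : ℕ → Fin p} {x : ℝ}

theorem IsCode.mem_dom (hω : S.IsCode ω x) (n : ℕ) : S.f^[n] x ∈ S.dom :=
  S.domF_subset_dom (hω n).1

theorem IsCode.iterate (hω : S.IsCode ω x) (t : ℕ) :
    S.IsCode (fun n => ω (t + n)) (S.f^[t] x) := fun n => by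
  rw [← Function.iterate_add_apply, add_comm n t]
  exact hω (t + n)

theorem IsCode.gIter_past (hω : S.IsCode ω x) {m k : ℕ} (hk : k ≤ m) :
    gIter S.g (past ω m) k (S.f^[m] x) = S.f^[m - k] x := by
  induction k with
  | zero => rfl
  | succ k ih =>
    change S.g (past ω m k) (gIter S.g (past ω m) k (S.f^[m] x)) = _
    rw [ih (by omega)]
    have h := hω (m - (k + 1))
    have h' := S.g_f_of_mem_isub h.1 h.2
    rw [← Function.iterate_succ_apply' S.f, show (m - (k + 1)).succ = m - k by omega] at h'
    rw [past, show m - 1 - k = m - (k + 1) by omega]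
    exact h'

theorem IsCode.gIter_past_self (hω : S.IsCode ω x) (m : ℕ) :
    gIter S.g (past ω m) m (S.f^[m] x) = x := by
  rw [hω.gIter_past le_rfl, Nat.sub_self]
  rfl

theorem derIter_add (n m : ℕ) (x : ℝ) :
    S.derIter (n + m) x = S.derIter n x * S.derIter m (S.f^[n] x) := by
  simp only [derIter, Finset.prod_range_add, ← Function.iterate_add_apply, add_comm]

theorem derIter_ne_zero {n : ℕ} (h : ∀ k < n, S.f^[k] x ∈ S.domF) : S.derIter n x ≠ 0 :=
  Finset.prod_ne_zero_iff.2 fun k hk => S.fder_ne_zero (h k (Finset.mem_range.1 hk))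

theorem hasDerivWithinAt_iterate_f {s : Set ℝ} {n : ℕ}
    (h : ∀ y ∈ s, ∀ k < n, S.f^[k] y ∈ S.domF) {y : ℝ} (hy : y ∈ s) :
    HasDerivWithinAt S.f^[n] (S.derIter n y) s y := by
  induction n with
  | zero => simpa [derIter] using hasDerivWithinAt_id y s
  | succ n ih =>
    have := (S.hasDerivWithinAt_f (h y hy n (by omega))).comp y
      (ih fun z hz k hk => h z hz k (by omega)) fun z hz => h z hz n (by omega)
    rw [derIter, Finset.prod_range_succ, mul_comm, Function.iterate_succ']
    exact this

/-! ### Preimages of parabolic points are not hyperbolic -/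

theorem exists_derIter_le_of_parabolic {k t : ℕ} (ht : 1 ≤ t)
    (hper : S.f^[t] (S.f^[k] x) = S.f^[k] x) (hder : |S.derIter t (S.f^[k] x)| = 1) :
    ∃ B, 0 < B ∧ ∀ n, |S.derIter n x| ≤ B := by
  have hstep : ∀ n, k ≤ n → |S.derIter (n + t) x| = |S.derIter n x| := by
    intro n hn
    obtain ⟨l, rfl⟩ := Nat.exists_eq_add_of_le hn
    rw [show k + l + t = k + (t + l) by omega, derIter_add, derIter_add (n := k),
      derIter_add (n := t), hper, abs_mul, abs_mul, abs_mul, hder, one_mul]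
  refine ⟨1 + ∑ i ∈ Finset.range (k + t), |S.derIter i x|, ?_, fun n => ?_⟩
  · have : 0 ≤ ∑ i ∈ Finset.range (k + t), |S.derIter i x| :=
      Finset.sum_nonneg fun _ _ => abs_nonneg _
    linarith
  induction n using Nat.strong_induction_on with
  | _ n ih =>
    rcases lt_or_ge n (k + t) with h | h
    · have := Finset.single_le_sum (f := fun i => |S.derIter i x|) (fun _ _ => abs_nonneg _)
        (Finset.mem_range.2 h)
      linarith
    · have := hstep (n - t) (by omega)
      rw [Nat.sub_add_cancel (by omega)] at this
      rw [this]
      exact ih _ (by omega)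

theorem not_mem_hypSet_of_derIter_le {B : ℝ} (hB : ∀ n, |S.derIter n x| ≤ B) :
    x ∉ S.hypSet := by
  rintro ⟨-, c₁, hc₁, c₂, hc₂, n, -, r, hr, -, hr0, h⟩
  have hB0 : 0 ≤ B := (abs_nonneg _).trans (hB 0)
  have hlim : Tendsto (fun k => c₂ * B * (2 * r k)) atTop (nhds (c₂ * B * (2 * 0))) :=
    (hr0.const_mul 2).const_mul _
  simp only [mul_zero] at hlim
  obtain ⟨k, hk⟩ := (hlim.eventually (gt_mem_nhds hc₁)).exists
  obtain ⟨hdom, hdiam, hdist⟩ := h k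
  have hxb : x ∈ ball x (r k) := mem_ball_self (hr k)
  have hbound : ∀ y ∈ ball x (r k), ‖S.derIter (n k) y‖ ≤ c₂ * B := by
    intro y hy
    have h1 := hdist y hy x hxb
    have h2 : 0 < |S.derIter (n k) x| := abs_pos.2 (derIter_ne_zero (hdom x hxb))
    rw [div_lt_iff₀ h2] at h1
    exact h1.le.trans (mul_le_mul_of_nonneg_left (hB _) hc₂.le)
  refine absurd (hdiam.trans_le (diam_le_of_forall_dist_le (by have := hr k; positivity) ?_))
    (not_lt.2 hk.le)
  rintro _ ⟨y, hy, rfl⟩ _ ⟨z, hz, rfl⟩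
  have h1 := (convex_ball x (r k)).norm_image_sub_le_of_norm_hasDerivWithin_le
    (fun w hw => hasDerivWithinAt_iterate_f hdom hw) hbound hz hy
  rw [dist_eq_norm]
  refine h1.trans (mul_le_mul_of_nonneg_left ?_ (by positivity))
  rw [← dist_eq_norm]
  have hy := mem_ball.1 hy
  have hz := mem_ball'.1 hz
  have := dist_triangle y x z
  linarith

end

section

variable {p : ℕ} {S : ExpansiveMarkovSystem p} {ω : ℕ → Fin p} {x Θ : ℝ}

/-! ### A criterion for membership in the hyperbolic set -/

variable (S) in
/-- The ball `B(x, r)` is mapped by `fⁿ` with distortion less than `c₂` onto a set of diameter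
greater than `c₁`. -/
def IsHypInstant (c₁ c₂ x : ℝ) (n : ℕ) (r : ℝ) : Prop :=
  (∀ y ∈ ball x r, ∀ j < n, S.f^[j] y ∈ S.domF) ∧
    c₁ < diam (S.f^[n] '' ball x r) ∧
    (∀ y ∈ ball x r, ∀ z ∈ ball x r, |S.derIter n y| / |S.derIter n z| < c₂)

theorem mem_hypSet_of_forall_exists {c₁ c₂ : ℝ} (hx : x ∈ S.limitSet) (hc₁ : 0 < c₁)
    (hc₂ : 0 < c₂)
    (h : ∀ (N : ℕ) (ε : ℝ), 0 < ε → ∃ n, N < n ∧ ∃ r, 0 < r ∧ r < ε ∧ S.IsHypInstant c₁ c₂ x n r) :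
    x ∈ S.hypSet := by
  have hstep : ∀ q : {q : ℕ × ℝ // 0 < q.2 ∧ S.IsHypInstant c₁ c₂ x q.1 q.2},
      ∃ q' : {q : ℕ × ℝ // 0 < q.2 ∧ S.IsHypInstant c₁ c₂ x q.1 q.2},
        q.1.1 < q'.1.1 ∧ q'.1.2 < q.1.2 / 2 := by
    rintro ⟨⟨n, r⟩, hr, -⟩
    obtain ⟨n', hn', r', hr', hlt, hi⟩ := h n (r / 2) (half_pos hr)
    exact ⟨⟨(n', r'), hr', hi⟩, hn', hlt⟩
  choose F hF1 hF2 using hstep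
  obtain ⟨n₀, -, r₀, hr₀, -, hi₀⟩ := h 0 1 one_pos
  let s : ℕ → {q : ℕ × ℝ // 0 < q.2 ∧ S.IsHypInstant c₁ c₂ x q.1 q.2} :=
    fun k => F^[k] ⟨(n₀, r₀), hr₀, hi₀⟩
  have hs : ∀ k, s (k + 1) = F (s k) := fun k => Function.iterate_succ_apply' F k _
  have hle : ∀ k, (s k).1.2 ≤ r₀ * (1 / 2) ^ k := by
    intro k
    induction k with
    | zero => simp [s]
    | succ k ih =>
      rw [hs, pow_succ]
      have := hF2 (s k)
      linarith
  refine ⟨hx, c₁, hc₁, c₂, hc₂, fun k => (s k).1.1, strictMono_nat_of_lt_succ fun k => ?_,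
    fun k => (s k).1.2, fun k => (s k).2.1, antitone_nat_of_succ_le fun k => ?_, ?_,
    fun k => (s k).2.2⟩
  · rw [hs]; exact hF1 _
  · rw [hs]
    have := hF2 (s k)
    have := (s k).2.1
    linarith
  · refine squeeze_zero (fun k => (s k).2.1.le) hle ?_
    simpa using (tendsto_pow_atTop_nhds_zero_of_lt_one (by norm_num : (0 : ℝ) ≤ 1 / 2)
      (by norm_num)).const_mul r₀

theorem abs_sub_lt_abs_sub_of_strictMonoOn {φ : ℝ → ℝ} {c ρ u e : ℝ}
    (hφ : StrictMonoOn φ (Icc (c - ρ) (c + ρ)) ∨ StrictAntiOn φ (Icc (c - ρ) (c + ρ)))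
    (he : e ∈ Icc (c - ρ) (c + ρ)) (hu : u ∈ Ioo c e ∨ u ∈ Ioo e c) :
    |φ u - φ c| < |φ e - φ c| := by
  have hc : c ∈ Icc (c - ρ) (c + ρ) := by
    constructor <;> linarith [he.1.trans he.2]
  have hu' : u ∈ Icc (c - ρ) (c + ρ) := by
    rcases hu with hu | hu
    · exact ⟨hc.1.trans hu.1.le, hu.2.le.trans he.2⟩
    · exact ⟨he.1.trans hu.1.le, hu.2.le.trans hc.2⟩
  rcases hφ with h | h <;> rcases hu with hu | hu
  · have h1 := h hc hu' hu.1
    have h2 := h hu' he hu.2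
    rw [abs_of_pos (by linarith), abs_of_pos (by linarith)]; linarith
  · have h1 := h he hu' hu.1
    have h2 := h hu' hc hu.2
    rw [abs_of_neg (by linarith), abs_of_neg (by linarith)]; linarith
  · have h1 := h hc hu' hu.1
    have h2 := h hu' he hu.2
    rw [abs_of_neg (by linarith), abs_of_neg (by linarith)]; linarith
  · have h1 := h he hu' hu.1
    have h2 := h hu' hc hu.2
    rw [abs_of_pos (by linarith), abs_of_pos (by linarith)]; linarith

theorem ball_min_subset_image {α : ℕ → Fin p} {n : ℕ} {c ρ : ℝ} {j : Fin p} (hρ : 0 < ρ)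
    (hj : Icc (c - ρ) (c + ρ) ⊆ S.Isub j) :
    ball (gIter S.g α n c) (min (S.spread α n (c - ρ) c) (S.spread α n (c + ρ) c)) ⊆
      gIter S.g α n '' Ioo (c - ρ) (c + ρ) := by
  refine Subset.trans ?_ (S.Ioo_subset_image_gIter α n (by linarith) hj)
  rw [Real.ball_eq_Ioo]
  have ha : c - ρ ∈ Icc (c - ρ) (c + ρ) := ⟨le_rfl, by linarith⟩
  have hb : c + ρ ∈ Icc (c - ρ) (c + ρ) := ⟨by linarith, le_rfl⟩
  have hc : c ∈ Icc (c - ρ) (c + ρ) := ⟨by linarith, by linarith⟩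
  have hac : c - ρ < c := by linarith
  have hcb : c < c + ρ := by linarith
  have h1 := min_le_left (S.spread α n (c - ρ) c) (S.spread α n (c + ρ) c)
  have h2 := min_le_right (S.spread α n (c - ρ) c) (S.spread α n (c + ρ) c)
  generalize min (S.spread α n (c - ρ) c) (S.spread α n (c + ρ) c) = r at h1 h2 ⊢
  rcases S.strictMonoOn_or_strictAntiOn_gIter α n (by linarith) hj with h | h
  · have h3 := h ha hc hac
    have h4 := h hc hb hcb
    rw [spread, abs_of_neg (by linarith)] at h1
    rw [spread, abs_of_pos (by linarith)] at h2
    refine Ioo_subset_Ioo ((min_le_left _ _).trans ?_) (le_trans ?_ (le_max_right _ _)) <;>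
      linarith
  · have h3 := h ha hc hac
    have h4 := h hc hb hcb
    rw [spread, abs_of_pos (by linarith)] at h1
    rw [spread, abs_of_neg (by linarith)] at h2
    refine Ioo_subset_Ioo ((min_le_right _ _).trans ?_) (le_trans ?_ (le_max_left _ _)) <;>
      linarith

theorem IsDistortionConst.isHypInstant (hΘ : S.IsDistortionConst Θ) {α : ℕ → Fin p} {n : ℕ}
    {a b c ρ K : ℝ} {j : Fin p} (hρ : 0 < ρ) (hj : Icc a b ⊆ S.Isub j) (ha : a ≤ c - ρ)
    (hb : c + ρ ≤ b) (hK : ∑ k ∈ Finset.range n, S.spread α k a b ≤ K) :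
    S.IsHypInstant (ρ / 2) (Real.exp (Θ * K) + 1) (gIter S.g α n c) n
      (min (S.spread α n (c - ρ) c) (S.spread α n (c + ρ) c)) := by
  have hsub : Icc (c - ρ) (c + ρ) ⊆ Icc a b := Icc_subset_Icc ha hb
  have hj' := hsub.trans hj
  have hdom : ∀ u ∈ Ioo (c - ρ) (c + ρ), u ∈ S.dom := fun u hu =>
    S.isub_subset_dom j (hj' (Ioo_subset_Icc_self hu))
  have hball := ball_min_subset_image (α := α) (n := n) hρ hj'
  set r := min (S.spread α n (c - ρ) c) (S.spread α n (c + ρ) c) with hr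
  refine ⟨fun y hy i hi => ?_, ?_, fun y hy z hz => ?_⟩
  · obtain ⟨u, hu, rfl⟩ := hball hy
    rw [S.iterate_f_gIter α hi.le (hdom u hu), show n - i = n - i - 1 + 1 by omega]
    exact S.gIter_succ_mem_domF α _ (hdom u hu)
  · obtain ⟨e, he, hre⟩ : ∃ e, (e = c - ρ ∨ e = c + ρ) ∧ r = S.spread α n e c := by
      rcases min_choice (S.spread α n (c - ρ) c) (S.spread α n (c + ρ) c) with h | h
      · exact ⟨_, Or.inl rfl, h⟩
      · exact ⟨_, Or.inr rfl, h⟩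
    set u := c + 3 / 4 * (e - c) with hu
    have heI : e ∈ Icc (c - ρ) (c + ρ) := by
      rcases he with rfl | rfl <;> constructor <;> linarith
    have huI : u ∈ Ioo (c - ρ) (c + ρ) := by
      rcases he with rfl | rfl <;> constructor <;> linarith
    have hue : u ∈ Ioo c e ∨ u ∈ Ioo e c := by
      rcases he with rfl | rfl
      · right; constructor <;> linarith
      · left; constructor <;> linarith
    have hcI : c ∈ Ioo (c - ρ) (c + ρ) := by constructor <;> linarith
    have hlt : |gIter S.g α n u - gIter S.g α n c| < r := by
      rw [hre]
      exact abs_sub_lt_abs_sub_of_strictMonoOn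
        (S.strictMonoOn_or_strictAntiOn_gIter α n (by linarith) hj') heI hue
    have hu1 : u ∈ S.f^[n] '' ball (gIter S.g α n c) r :=
      ⟨gIter S.g α n u, hlt, S.iterate_f_gIter_self α n (hdom u huI)⟩
    have hc1 : c ∈ S.f^[n] '' ball (gIter S.g α n c) r :=
      ⟨gIter S.g α n c, mem_ball_self ((abs_nonneg _).trans_lt hlt),
        S.iterate_f_gIter_self α n (hdom c hcI)⟩
    have hbdd : Bornology.IsBounded (S.f^[n] '' ball (gIter S.g α n c) r) := by
      refine (isBounded_Ioo (c - ρ) (c + ρ)).subset ?_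
      rintro _ ⟨y, hy, rfl⟩
      obtain ⟨v, hv, rfl⟩ := hball hy
      rwa [S.iterate_f_gIter_self α n (hdom v hv)]
    refine lt_of_lt_of_le ?_ (dist_le_diam_of_mem hbdd hu1 hc1)
    rw [Real.dist_eq, hu, add_sub_cancel_left, abs_mul]
    have : |e - c| = ρ := by
      rcases he with rfl | rfl
      · rw [abs_of_neg] <;> linarith
      · rw [abs_of_pos] <;> linarith
    rw [this, abs_of_pos (by norm_num)]
    linarith
  · obtain ⟨u, hu, rfl⟩ := hball hy
    obtain ⟨v, hv, rfl⟩ := hball hz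
    have h := hΘ.abs_gIterDer_le hj hK (hsub (Ioo_subset_Icc_self hv))
      (hsub (Ioo_subset_Icc_self hu))
    rw [S.derIter_gIter α n (hdom u hu), S.derIter_gIter α n (hdom v hv), abs_inv, abs_inv,
      inv_div_inv]
    refine lt_of_le_of_lt ((div_le_iff₀ (abs_pos.2 (S.gIterDer_ne_zero α n (hdom u hu)))).2 h) ?_
    linarith

/-- If infinitely many inverse branches along the orbit of `x` are defined on a neighbourhood of
uniform size, with images of uniformly bounded total length, then `x` belongs to `H`. -/
theorem IsCode.mem_hypSet (hω : S.IsCode ω x) (hx : x ∈ S.limitSet) {ρ K : ℝ} (hρ : 0 < ρ)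
    (h : ∀ N, ∃ m, N ≤ m ∧ ∃ j a b, Icc a b ⊆ S.Isub j ∧ a ≤ S.f^[m] x - ρ ∧
      S.f^[m] x + ρ ≤ b ∧ ∑ k ∈ Finset.range m, S.spread (past ω m) k a b ≤ K) :
    x ∈ S.hypSet := by
  obtain ⟨Θ, hΘ⟩ := S.exists_isDistortionConst
  refine mem_hypSet_of_forall_exists (c₁ := ρ / 2) (c₂ := Real.exp (Θ * K) + 1) hx (half_pos hρ)
    (by positivity) fun N ε hε => ?_
  obtain ⟨N', hN'⟩ := S.exists_spread_lt hε
  obtain ⟨m, hm, j, a, b, hj, ha, hb, hK⟩ := h (max N N' + 1)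
  have h1 := le_max_left N N'
  have h2 := le_max_right N N'
  set c := S.f^[m] x with hc
  have hinst := hΘ.isHypInstant hρ hj ha hb hK
  rw [hc, hω.gIter_past_self, ← hc] at hinst
  have hca : c - ρ ∈ S.Isub j := hj ⟨ha, by linarith⟩
  have hcb : c + ρ ∈ S.Isub j := hj ⟨by linarith, hb⟩
  have hcc : c ∈ S.Isub j := hj ⟨by linarith, by linarith⟩
  have hpos : ∀ e ∈ S.Isub j, e ≠ c → 0 < S.spread (past ω m) m e c := fun e he hne =>
    abs_pos.2 (sub_ne_zero.2 fun heq => hne (S.injOn_gIter _ m (S.isub_subset_dom j he)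
      (S.isub_subset_dom j hcc) heq))
  refine ⟨m, by omega, _, lt_min (hpos _ hca (by linarith)) (hpos _ hcb (by linarith)),
    (min_le_left _ _).trans_lt (hN' _ m (by omega) j _ hca _ hcc), hinst⟩

end

section

variable {p : ℕ} {S : ExpansiveMarkovSystem p} {ω : ℕ → Fin p} {x Θ : ℝ}

/-! ### Preimages of non-parabolic periodic points -/

variable (S) in
theorem exists_closedBall_subset {y : ℝ} {j : Fin p} (hy : y ∈ interior (S.Isub j)) :
    ∃ δ > 0, ∀ u, |u - y| ≤ δ → u ∈ S.Isub j := by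
  obtain ⟨δ, hδ, h⟩ := Metric.nhds_basis_closedBall.mem_iff.1 (mem_interior_iff_mem_nhds.1 hy)
  exact ⟨δ, hδ, fun u hu => h (by rwa [mem_closedBall, Real.dist_eq])⟩

theorem IsCode.mem_interior (hω : S.IsCode ω x) (n : ℕ) :
    S.f^[n] x ∈ interior (S.Isub (ω n)) := by
  obtain ⟨i, hi, -⟩ := S.exists_index (hω n).1
  rwa [S.eq_of_mem_isub (hω n).2 (interior_subset hi)]

theorem IsCode.iterate_eq_of_periodic {k t : ℕ}
    (hper : S.f^[t] (S.f^[k] x) = S.f^[k] x) (s i : ℕ) :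
    S.f^[k + t * s + i] x = S.f^[k + i] x := by
  have h : S.f^[t * s] (S.f^[k] x) = S.f^[k] x := by
    rw [Function.iterate_mul]
    exact Function.iterate_fixed hper s
  rw [show k + t * s + i = i + (t * s + k) by omega, Function.iterate_add_apply,
    Function.iterate_add_apply S.f (t * s), h, ← Function.iterate_add_apply, add_comm]

theorem IsCode.gIter_past_of_periodic (hω : S.IsCode ω x) {k t : ℕ}
    (hper : S.f^[t] (S.f^[k] x) = S.f^[k] x) {s l : ℕ} (hl : l < s) (u : ℝ) :
    gIter S.g (past ω (k + t * s)) (t * (l + 1)) u =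
      gIter S.g (past ω (k + t)) t (gIter S.g (past ω (k + t * s)) (t * l) u) := by
  rw [mul_add, mul_one, gIter_add, past_add]
  refine gIter_congr _ (fun i hi => ?_) _
  obtain ⟨d, rfl⟩ := Nat.exists_eq_add_of_lt hl
  have e1 : k + t * (l + d + 1) - t * l = k + t * d + t := by
    rw [show k + t * (l + d + 1) = k + t * d + t + t * l by ring]; omega
  have e2 : k + t * d + t - 1 - i = k + t * d + (t - 1 - i) := by omega
  have e3 : k + t - 1 - i = k + (t - 1 - i) := by omega
  rw [e1, past, past, e2, e3]
  refine S.eq_of_mem_isub (hω _).2 ?_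
  rw [iterate_eq_of_periodic hper]
  exact (hω _).2

theorem IsCode.abs_gIterDer_lt_one (hω : S.IsCode ω x) {k t : ℕ} (ht : 1 ≤ t)
    (hper : S.f^[t] (S.f^[k] x) = S.f^[k] x) (hder : |S.derIter t (S.f^[k] x)| ≠ 1) :
    |gIterDer S.g S.gder (past ω (k + t)) t (S.f^[k] x)| < 1 := by
  set y := S.f^[k] x with hy
  set lam := gIterDer S.g S.gder (past ω (k + t)) t y with hlam
  have hyd : y ∈ S.dom := hω.mem_dom k
  have hGy : gIter S.g (past ω (k + t)) t y = y := by
    have := hω.gIter_past (m := k + t) (k := t) (by omega)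
    rwa [add_comm k t, Function.iterate_add_apply, hper, Nat.add_sub_cancel_left,
      add_comm t k] at this
  have hlam1 : |lam| ≠ 1 := by
    have := S.derIter_gIter (past ω (k + t)) t hyd
    rw [hGy] at this
    rw [this, abs_inv] at hder
    exact fun h => hder (by rw [← hlam, h, inv_one])
  by_contra hge
  have hgt : 1 < |lam| := lt_of_le_of_ne (not_lt.1 hge) hlam1.symm
  have hd := (S.hasDerivWithinAt_gIter (past ω (k + t)) t hyd).hasDerivAt
    (mem_of_superset (mem_interior_iff_mem_nhds.1 (hω.mem_interior k)) (S.isub_subset_dom _))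
  rw [hasDerivAt_iff_isLittleO] at hd
  have hev := hd.def (sub_pos.2 hgt)
  obtain ⟨ρ, hρ, hev⟩ := Metric.eventually_nhds_iff.1 hev
  obtain ⟨δ₁, hδ₁, hj⟩ := S.exists_closedBall_subset (hω.mem_interior k)
  obtain ⟨δ₂, hδ₂, heq⟩ := S.exists_equicontinuous hρ
  set u := y + min δ₁ δ₂ with hu
  have hmin : 0 < min δ₁ δ₂ := lt_min hδ₁ hδ₂
  have huy : |u - y| = min δ₁ δ₂ := by rw [hu, add_sub_cancel_left, abs_of_pos hmin]
  have huj : u ∈ S.Isub (ω k) := hj u (huy.trans_le (min_le_left _ _))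
  obtain ⟨N, hN⟩ := S.exists_spread_lt hmin
  have hyy : ∀ l ≤ N, gIter S.g (past ω (k + t * N)) (t * l) y = y := by
    intro l
    induction l with
    | zero => intro; rfl
    | succ l ih =>
      intro h
      rw [hω.gIter_past_of_periodic hper (by omega), ih (by omega), hGy]
  have hexp : ∀ l ≤ N, |u - y| ≤ S.spread (past ω (k + t * N)) (t * l) u y := by
    intro l
    induction l with
    | zero => intro; exact le_rfl
    | succ l ih =>
      intro h
      refine (ih (by omega)).trans ?_
      have hlt := heq (past ω (k + t * N)) (t * l) _ u huj y (hω k).2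
        (huy.trans_le (min_le_right _ _))
      rw [spread, hyy l (by omega)] at hlt ⊢
      rw [spread, hyy (l + 1) h, hω.gIter_past_of_periodic hper (by omega)]
      generalize gIter S.g (past ω (k + t * N)) (t * l) u = v at hlt ⊢
      have h1 := hev (y := v) hlt
      rw [hGy] at h1
      simp only [Real.norm_eq_abs, smul_eq_mul, ← hlam] at h1
      have h2 := abs_sub_abs_le_abs_sub ((v - y) * lam) (gIter S.g (past ω (k + t)) t v - y)
      rw [abs_sub_comm ((v - y) * lam), abs_mul] at h2
      nlinarith
  have := hN (past ω (k + t * N)) (t * N) (Nat.le_mul_of_pos_left N ht) _ u huj y (hω k).2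
  have := hexp N le_rfl
  linarith

theorem IsCode.mem_hypSet_of_periodic (hω : S.IsCode ω x) (hx : x ∈ S.limitSet) {k t : ℕ}
    (ht : 1 ≤ t) (hper : S.f^[t] (S.f^[k] x) = S.f^[k] x)
    (hder : |S.derIter t (S.f^[k] x)| ≠ 1) : x ∈ S.hypSet := by
  have hlt := hω.abs_gIterDer_lt_one ht hper hder
  set y := S.f^[k] x with hy
  set lam := gIterDer S.g S.gder (past ω (k + t)) t y with hlam
  have hyd : y ∈ S.dom := hω.mem_dom k
  have hGy : gIter S.g (past ω (k + t)) t y = y := by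
    have := hω.gIter_past (m := k + t) (k := t) (by omega)
    rwa [add_comm k t, Function.iterate_add_apply, hper, Nat.add_sub_cancel_left,
      add_comm t k] at this
  have hd := (S.hasDerivWithinAt_gIter (past ω (k + t)) t hyd).hasDerivAt
    (mem_of_superset (mem_interior_iff_mem_nhds.1 (hω.mem_interior k)) (S.isub_subset_dom _))
  rw [hasDerivAt_iff_isLittleO] at hd
  obtain ⟨ρ₁, hρ₁, hev⟩ := Metric.eventually_nhds_iff.1
    (hd.def (by linarith : 0 < (1 - |lam|) / 2))
  obtain ⟨δ₁, hδ₁, hj⟩ := S.exists_closedBall_subset (hω.mem_interior k)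
  obtain ⟨M, hM1, hM⟩ := S.exists_lipschitz
  set q := (1 + |lam|) / 2 with hq
  have hq0 : 0 ≤ q := by have := abs_nonneg lam; linarith
  have hq1 : q < 1 := by linarith
  set ρ := min (ρ₁ / 2) δ₁ with hρ
  have hρ0 : 0 < ρ := lt_min (half_pos hρ₁) hδ₁
  have hρ1 : ρ < ρ₁ := (min_le_left _ _).trans_lt (half_lt_self hρ₁)
  have hstep : ∀ u, |u - y| ≤ ρ → |gIter S.g (past ω (k + t)) t u - y| ≤ q * |u - y| := by
    intro u hu
    have h1 := hev (y := u) (hu.trans_lt hρ1)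
    rw [hGy] at h1
    simp only [Real.norm_eq_abs, smul_eq_mul, ← hlam] at h1
    have h2 := abs_sub_abs_le_abs_sub (gIter S.g (past ω (k + t)) t u - y) ((u - y) * lam)
    rw [abs_mul] at h2
    rw [hq]
    linarith
  have hcontr : ∀ u, |u - y| ≤ ρ → ∀ s, ∀ l ≤ s,
      |gIter S.g (past ω (k + t * s)) (t * l) u - y| ≤ q ^ l * ρ := by
    intro u hu s l
    induction l with
    | zero => intro; simpa [gIter] using hu
    | succ l ih =>
      intro h
      have ih := ih (by omega)
      rw [hω.gIter_past_of_periodic hper (by omega)]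
      have hql : q ^ l * ρ ≤ ρ := by
        have := pow_le_one₀ (n := l) hq0 hq1.le
        nlinarith
      refine (hstep _ (ih.trans hql)).trans ?_
      rw [pow_succ]
      nlinarith
  have hyy : ∀ s, ∀ l ≤ s, gIter S.g (past ω (k + t * s)) (t * l) y = y := by
    intro s l
    induction l with
    | zero => intro; rfl
    | succ l ih =>
      intro h
      rw [hω.gIter_past_of_periodic hper (by omega), ih (by omega), hGy]
  have hsp : ∀ u, |u - y| ≤ ρ → ∀ s, ∀ l < s, ∀ i < t,
      S.spread (past ω (k + t * s)) (t * l + i) u y ≤ M ^ t * (q ^ l * ρ) := by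
    intro u hu s l hl i hi
    rw [spread_add, hyy s l hl.le]
    have h1 := hcontr u hu s l hl.le
    have hql : q ^ l * ρ ≤ ρ := by
      have := pow_le_one₀ (n := l) hq0 hq1.le
      nlinarith
    have h2 := S.spread_le_pow hM1 hM (fun n => past ω (k + t * s) (t * l + n)) i
      (hj _ (h1.trans (hql.trans (min_le_right _ _)))) (hω k).2
    refine h2.trans (mul_le_mul (pow_le_pow_right₀ hM1 hi.le) h1 (abs_nonneg _) (by positivity))
  have hIcc : Icc (y - ρ) (y + ρ) ⊆ S.Isub (ω k) := fun u hu =>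
    hj u ((abs_sub_le_iff.2 ⟨by linarith [hu.2], by linarith [hu.1]⟩).trans (min_le_right _ _))
  have hsum : ∀ s, ∀ l ≤ s, ∑ i ∈ Finset.range (t * l),
      S.spread (past ω (k + t * s)) i (y - ρ) (y + ρ) ≤
        ∑ i ∈ Finset.range l, t * (2 * (M ^ t * (q ^ i * ρ))) := by
    intro s l
    induction l with
    | zero => intro; simp
    | succ l ih =>
      intro h
      rw [Finset.sum_range_succ, mul_add, mul_one, Finset.sum_range_add]
      refine add_le_add (ih (by omega)) ?_
      refine (Finset.sum_le_card_nsmul _ _ (2 * (M ^ t * (q ^ l * ρ))) fun i hi => ?_).trans ?_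
      · have hi := Finset.mem_range.1 hi
        have h1 := hsp (y - ρ) (by rw [sub_sub_cancel_left, abs_neg, abs_of_pos hρ0]) s l h i hi
        have h2 := hsp (y + ρ) (by rw [add_sub_cancel_left, abs_of_pos hρ0]) s l h i hi
        have h3 := spread_triangle (S := S) (past ω (k + t * s)) (t * l + i) (y - ρ) y (y + ρ)
        have h4 : S.spread (past ω (k + t * s)) (t * l + i) y (y + ρ) =
          S.spread (past ω (k + t * s)) (t * l + i) (y + ρ) y := abs_sub_comm _ _
        linarith
      · rw [Finset.card_range, nsmul_eq_mul]
  refine hω.mem_hypSet hx (K := t * (2 * (M ^ t * ρ)) * (1 - q)⁻¹ + k * S.len) hρ0 fun N =>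
    ⟨k + t * N, ?_, ω k, y - ρ, y + ρ, hIcc, ?_, ?_, ?_⟩
  · have := Nat.le_mul_of_pos_left N ht
    omega
  · rw [show k + t * N = k + t * N + 0 by omega, IsCode.iterate_eq_of_periodic hper, add_zero]
  · rw [show k + t * N = k + t * N + 0 by omega, IsCode.iterate_eq_of_periodic hper, add_zero]
  · have hs := hsum N N le_rfl
    generalize past ω (k + t * N) = α at hs ⊢
    rw [add_comm k, Finset.sum_range_add]
    refine add_le_add (hs.trans ?_) ?_
    · have hgeom : ∑ i ∈ Finset.range N, q ^ i ≤ (1 - q)⁻¹ := by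
        rw [← tsum_geometric_of_lt_one hq0 hq1]
        exact (summable_geometric_of_lt_one hq0 hq1).sum_le_tsum _ fun i _ => pow_nonneg hq0 i
      refine le_trans (le_of_eq ?_)
        (mul_le_mul_of_nonneg_left hgeom (by positivity : 0 ≤ t * (2 * (M ^ t * ρ))))
      rw [Finset.mul_sum]
      exact Finset.sum_congr rfl fun i _ => by ring
    · refine (Finset.sum_le_card_nsmul _ _ S.len fun i _ =>
        S.spread_le_len α _ (by linarith) hIcc).trans ?_
      rw [Finset.card_range, nsmul_eq_mul]

end

section

variable {p : ℕ} {S : ExpansiveMarkovSystem p} {ω : ℕ → Fin p} {x Θ : ℝ}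

/-! ### Limit points of an orbit -/

variable (S) in
/-- The set of limit points of the forward orbit of `x`. -/
def limitPts (x : ℝ) : Set ℝ :=
  {w | ∀ ε, 0 < ε → ∀ N : ℕ, ∃ n, N ≤ n ∧ |S.f^[n] x - w| < ε}

theorem IsCode.exists_tendsto (hω : S.IsCode ω x) {m : ℕ → ℕ} (hm : ∀ k, k ≤ m k) :
    ∃ w ∈ S.limitPts x, ∃ φ : ℕ → ℕ, StrictMono φ ∧
      Tendsto (fun k => S.f^[m (φ k)] x) atTop (nhds w) := by
  obtain ⟨w, -, φ, hφ, h⟩ := S.isCompact_domF.tendsto_subseq (x := fun k => S.f^[m k] x)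
    fun k => (hω _).1
  refine ⟨w, fun ε hε N => ?_, φ, hφ, h⟩
  obtain ⟨K, hK⟩ := Metric.tendsto_atTop.1 h ε hε
  have := hK (max K N) (le_max_left _ _)
  exact ⟨_, (le_max_right K N).trans ((hφ.id_le _).trans (hm _)), this⟩

theorem IsCode.limitPts_nonempty (hω : S.IsCode ω x) : (S.limitPts x).Nonempty := by
  obtain ⟨w, hw, -⟩ := hω.exists_tendsto (m := id) fun k => le_rfl
  exact ⟨w, hw⟩

theorem isClosed_limitPts : IsClosed (S.limitPts x) := by
  refine isClosed_of_closure_subset fun w hw ε hε N => ?_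
  obtain ⟨v, hv, hvw⟩ := Metric.mem_closure_iff.1 hw (ε / 2) (half_pos hε)
  obtain ⟨n, hn, h⟩ := hv (ε / 2) (half_pos hε) N
  rw [Real.dist_eq, abs_sub_comm] at hvw
  exact ⟨n, hn, (abs_sub_le _ v _).trans_lt (by linarith)⟩

theorem IsCode.limitPts_subset (hω : S.IsCode ω x) : S.limitPts x ⊆ S.domF := fun w hw =>
  S.isCompact_domF.isClosed.closure_subset <| Metric.mem_closure_iff.2 fun ε hε => by
    obtain ⟨n, -, hn⟩ := hw ε hε 0
    exact ⟨_, (hω n).1, by rwa [dist_comm]⟩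

theorem IsCode.f_mem_limitPts (hω : S.IsCode ω x) {w : ℝ} (hw : w ∈ S.limitPts x) :
    S.f w ∈ S.limitPts x := by
  intro ε hε N
  obtain ⟨δ, hδ, h⟩ := Metric.continuousOn_iff.1 S.continuousOn_f w (hω.limitPts_subset hw) ε hε
  obtain ⟨n, hn, hnw⟩ := hw δ hδ N
  refine ⟨n + 1, by omega, ?_⟩
  rw [Function.iterate_succ_apply']
  exact h _ (hω n).1 hnw

theorem IsCode.iterate_mem_limitPts (hω : S.IsCode ω x) {w : ℝ} (hw : w ∈ S.limitPts x)
    (n : ℕ) : S.f^[n] w ∈ S.limitPts x := by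
  induction n with
  | zero => exact hw
  | succ n ih => rw [Function.iterate_succ_apply']; exact hω.f_mem_limitPts ih

theorem IsCode.exists_limitPt_near (hω : S.IsCode ω x) {ε : ℝ} (hε : 0 < ε) :
    ∃ n₀, ∀ n, n₀ ≤ n → ∃ w ∈ S.limitPts x, |S.f^[n] x - w| < ε := by
  by_contra! h
  choose m hm hfar using h
  obtain ⟨w, hw, φ, -, hlim⟩ := hω.exists_tendsto hm
  obtain ⟨K, hK⟩ := Metric.tendsto_atTop.1 hlim ε hε
  exact absurd (hK K le_rfl) (not_lt.2 (hfar (φ K) w hw))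

theorem IsCode.continuousAt_iterate (hω : S.IsCode ω x) {w : ℝ} (hw : w ∈ S.limitPts x) (h : ℕ) :
    ∀ ε, 0 < ε → ∃ δ, 0 < δ ∧ ∀ n, |S.f^[n] x - w| < δ → |S.f^[n + h] x - S.f^[h] w| < ε := by
  induction h with
  | zero => exact fun ε hε => ⟨ε, hε, fun n hn => hn⟩
  | succ h ih =>
    intro ε hε
    obtain ⟨δ, hδ, hf⟩ := Metric.continuousOn_iff.1 S.continuousOn_f _
      (hω.limitPts_subset (hω.iterate_mem_limitPts hw h)) ε hε
    obtain ⟨δ', hδ', h'⟩ := ih δ hδ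
    refine ⟨δ', hδ', fun n hn => ?_⟩
    rw [← add_assoc, Function.iterate_succ_apply', Function.iterate_succ_apply']
    exact hf _ (hω _).1 (h' n hn)

/-- Near a non-periodic limit point, short returns are impossible. -/
theorem IsCode.exists_no_short_return (hω : S.IsCode ω x) {q : ℝ} (hq : q ∈ S.limitPts x)
    (hper : ∀ h, 1 ≤ h → S.f^[h] q ≠ q) (N : ℕ) {ε₀ : ℝ} (hε₀ : 0 < ε₀) :
    ∃ ε, 0 < ε ∧ ε ≤ ε₀ ∧ ∀ n, |S.f^[n] x - q| < ε → ∀ h, 1 ≤ h → h ≤ N →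
      ε ≤ |S.f^[n + h] x - q| := by
  induction N with
  | zero => exact ⟨ε₀, hε₀, le_rfl, fun n _ h h1 h2 => by omega⟩
  | succ N ih =>
    obtain ⟨ε, hε, hle, hret⟩ := ih
    have hpos : 0 < |S.f^[N + 1] q - q| := abs_pos.2 (sub_ne_zero.2 (hper (N + 1) (by omega)))
    obtain ⟨δ, hδ, hc⟩ := hω.continuousAt_iterate hq (N + 1) _ (half_pos hpos)
    refine ⟨min ε (min δ (|S.f^[N + 1] q - q| / 2)), by positivity, (min_le_left _ _).trans hle,
      fun n hn h h1 h2 => ?_⟩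
    rcases Nat.lt_or_ge h (N + 1) with hlt | hge
    · exact (min_le_left _ _).trans
        (hret n (hn.trans_le (min_le_left _ _)) h h1 (by omega))
    · obtain rfl : h = N + 1 := by omega
      have h3 := hc n (hn.trans_le ((min_le_right _ _).trans (min_le_left _ _)))
      refine ((min_le_right _ _).trans (min_le_right _ _)).trans ?_
      have h4 := abs_sub_le (S.f^[N + 1] q) (S.f^[n + (N + 1)] x) q
      rw [abs_sub_comm (S.f^[N + 1] q) (S.f^[n + (N + 1)] x)] at h4
      linarith

/-! ### Returns to a one-sided gap -/

/-- The interval `[a, b]` has endpoint `q` and lies inside a gap of `W` of length `d` adjacent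
to `q`. -/
def IsGapInterval (W : Set ℝ) (q a b d : ℝ) : Prop :=
  (a = q ∧ ∀ w ∈ W, w ∉ Ioo q (q + d)) ∨ (b = q ∧ ∀ w ∈ W, w ∉ Ioo (q - d) q)

theorem IsGapInterval.mem {W : Set ℝ} {q a b d : ℝ} (hgap : IsGapInterval W q a b d)
    (hab : a ≤ b) : q ∈ Icc a b := by
  rcases hgap with ⟨rfl, -⟩ | ⟨rfl, -⟩
  exacts [left_mem_Icc.2 hab, right_mem_Icc.2 hab]

theorem IsGapInterval.eq_of_mem {W : Set ℝ} {q a b d u : ℝ} (hgap : IsGapInterval W q a b d)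
    (hd : b - a < d) (hu : u ∈ Icc a b) (huW : u ∈ W) : u = q := by
  rcases hgap with ⟨rfl, h⟩ | ⟨rfl, h⟩
  · by_contra hne
    exact h u huW ⟨lt_of_le_of_ne hu.1 (Ne.symm hne), by linarith [hu.2]⟩
  · by_contra hne
    exact h u huW ⟨by linarith [hu.1], lt_of_le_of_ne hu.2 hne⟩

theorem IsGapInterval.abs_sub_le {W : Set ℝ} {q a b d v : ℝ} {φ : ℝ → ℝ}
    (hgap : IsGapInterval W q a b d) (hd : b - a ≤ d / 4) (hφ : ContinuousOn φ (Icc a b))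
    (hq : q ∉ φ '' Icc a b) (hv : v ∈ Icc a b) (hφv : φ v ∈ Icc a b)
    (hφd : |φ v - φ q| < d / 4) {w : ℝ} (hw : w ∈ W) : |q - φ q| ≤ |w - φ q| := by
  have hlt := abs_sub_lt_iff.1 hφd
  rcases hgap with ⟨rfl, h⟩ | ⟨rfl, h⟩
  · have h1 : a < φ a := by
      by_contra hle
      obtain ⟨u, hu, hua⟩ := intermediate_value_Icc hv.1 (hφ.mono (Icc_subset_Icc_right hv.2))
        ⟨not_lt.1 hle, hφv.1⟩
      exact hq ⟨u, Icc_subset_Icc_right hv.2 hu, hua⟩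
    have h2 := hφv.2
    rw [abs_sub_comm, abs_of_pos (by linarith)]
    rcases le_or_gt w a with hwa | hwa
    · rw [abs_sub_comm, abs_of_pos] <;> linarith
    · have : a + d ≤ w := not_lt.1 fun hlt => h w hw ⟨hwa, hlt⟩
      rw [abs_of_pos] <;> linarith
  · have h1 : φ b < b := by
      by_contra hle
      obtain ⟨u, hu, hua⟩ := intermediate_value_Icc hv.2 (hφ.mono (Icc_subset_Icc_left hv.1))
        ⟨hφv.2, not_lt.1 hle⟩
      exact hq ⟨u, Icc_subset_Icc_left hv.1 hu, hua⟩
    have h2 := hφv.1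
    rw [abs_of_pos (by linarith)]
    rcases le_or_gt b w with hwa | hwa
    · rw [abs_of_pos] <;> linarith
    · have : w ≤ b - d := not_lt.1 fun hlt => h w hw ⟨hlt, hwa⟩
      rw [abs_of_neg] <;> linarith

theorem IsDistortionConst.sum_spread_collar_le (hΘ : S.IsDistortionConst Θ) {α : ℕ → Fin p}
    {n k : ℕ} {a b η K : ℝ} {j : Fin p} (hab : a < b) (hη : 0 ≤ η)
    (hj : Icc (a - η) (b + η) ⊆ S.Isub j) (hK : ∑ i ∈ Finset.range n, S.spread α i a b ≤ K)
    (hηC : Real.exp (Θ * (3 * K)) * η ≤ b - a) (hk : k ≤ n) :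
    ∑ i ∈ Finset.range k, S.spread α i (a - η) (b + η) ≤ 3 * K := by
  have h := hΘ.spread_collar_le hab (by linarith) (by linarith) hj hK (by simpa using hηC)
    (by simpa using hηC)
  calc _ ≤ ∑ i ∈ Finset.range k, 3 * S.spread α i a b :=
        Finset.sum_le_sum fun i hi => h i (by have := Finset.mem_range.1 hi; omega)
    _ = 3 * ∑ i ∈ Finset.range k, S.spread α i a b := (Finset.mul_sum ..).symm
    _ ≤ 3 * ∑ i ∈ Finset.range n, S.spread α i a b := by
        refine mul_le_mul_of_nonneg_left ?_ (by norm_num)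
        exact Finset.sum_le_sum_of_subset_of_nonneg (Finset.range_mono hk)
          fun i _ _ => S.spread_nonneg α i a b
    _ ≤ 3 * K := by linarith

theorem IsCode.sum_spread_le_two_mul_len (hω : S.IsCode ω x) (hΘ : S.IsDistortionConst Θ)
    {q a b d C δ η ε ε₁ : ℝ} {j : Fin p} {N n₀ : ℕ} (hC : C = Real.exp (Θ * (3 * (2 * S.len))))
    (hq : q ∈ S.limitPts x) (hper : ∀ h, 1 ≤ h → S.f^[h] q ≠ q)
    (hgap : IsGapInterval (S.limitPts x) q a b d)
    (hδ : 0 < δ) (hab : b - a = δ) (hδd : δ ≤ d / 4) (hη : 0 < η)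
    (hj : Icc (a - η) (b + η) ⊆ S.Isub j) (hηC : C * η ≤ δ)
    (hspr : ∀ (α : ℕ → Fin p) k, S.spread α k a b < d / 4)
    (hN : ∀ (α : ℕ → Fin p) k, N ≤ k → S.spread α k a b < η ∧ 8 * C * S.spread α k a b ≤ δ)
    (hret : ∀ n, |S.f^[n] x - q| < ε₁ → ∀ h, 1 ≤ h → h ≤ N → ε₁ ≤ |S.f^[n + h] x - q|)
    (hε : 0 < ε) (hεε₁ : ε ≤ ε₁) (hεη : ε ≤ η) (hεC : C * S.len * ε ≤ δ * (ε₁ / 4))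
    (hnear : ∀ n, n₀ ≤ n → ∃ w ∈ S.limitPts x, |S.f^[n] x - w| < ε / 4) (m : ℕ)
    (hmq : |S.f^[m] x - q| < ε) :
    ∑ k ∈ Finset.range (m - n₀), S.spread (past ω m) k a b ≤ 2 * S.len := by
  have hab' : a < b := by linarith
  have hL := S.len_pos
  have hC0 : 0 < C := by rw [hC]; exact Real.exp_pos _
  have hηC' : Real.exp (Θ * (3 * (2 * S.len))) * η ≤ b - a := by rwa [← hC, hab]
  have hsub : Icc a b ⊆ Icc (a - η) (b + η) := Icc_subset_Icc (by linarith) (by linarith)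
  have hjab := hsub.trans hj
  have hqab := hgap.mem hab'.le
  have ha : a ∈ Icc a b := left_mem_Icc.2 hab'.le
  have hb : b ∈ Icc a b := right_mem_Icc.2 hab'.le
  induction m using Nat.strong_induction_on with
  | _ m ih =>
    by_cases hno : ∀ h, 1 ≤ h → h < m - n₀ →
        Disjoint (gIter S.g (past ω m) h '' Ioo a b) (Ioo a b)
    · have := S.sum_spread_le_of_no_return (past ω m) hab'.le hjab hno
      linarith
    have hno' : ∃ h, 1 ≤ h ∧ h < m - n₀ ∧
        ¬Disjoint (gIter S.g (past ω m) h '' Ioo a b) (Ioo a b) := by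
      push Not at hno; exact hno
    obtain ⟨hh1, hhm, hhd⟩ := Nat.find_spec hno'
    have hmin : ∀ h', 1 ≤ h' → h' < Nat.find hno' →
        Disjoint (gIter S.g (past ω m) h' '' Ioo a b) (Ioo a b) := fun h' h1 h2 => by
      by_contra hd
      exact Nat.find_min hno' h2 ⟨h1, by omega, hd⟩
    generalize Nat.find hno' = h at hh1 hhm hhd hmin
    obtain ⟨_, ⟨v, hv, rfl⟩, hφv⟩ := Set.not_disjoint_iff.1 hhd
    have hv := Ioo_subset_Icc_self hv
    have hφv := Ioo_subset_Icc_self hφv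
    have hsum1 := S.sum_spread_le_of_no_return (past ω m) hab'.le hjab hmin
    have hxm : S.f^[m] x ∈ Icc (a - η) (b + η) := by
      have := abs_sub_lt_iff.1 hmq
      constructor <;> linarith [hqab.1, hqab.2]
    have hφx : gIter S.g (past ω m) h (S.f^[m] x) = S.f^[m - h] x :=
      hω.gIter_past (by omega)
    -- distortion up to the first return
    have hdist : S.spread (past ω m) h (S.f^[m] x) q * δ ≤
        C * S.spread (past ω m) h a b * |S.f^[m] x - q| := by
      have h1 := hΘ.sum_spread_collar_le hab' hη.le hj (K := 2 * S.len) (n := h) (by linarith)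
        hηC' le_rfl
      have h2 := hΘ.spread_mul_le hj h1 hxm (hsub hqab) (hsub ha) (hsub hb)
      rwa [← hC, abs_sub_comm a b, hab, abs_of_pos hδ] at h2
    have hqφ : q ∉ gIter S.g (past ω m) h '' Icc a b := by
      rintro ⟨u, hu, huq⟩
      have hfq : S.f^[h] q = u := by
        rw [← huq, S.iterate_f_gIter_self _ _ (S.isub_subset_dom j (hjab hu))]
      have huW := hω.iterate_mem_limitPts hq h
      rw [hfq] at huW
      exact hper h hh1 (hfq.trans (hgap.eq_of_mem (by linarith) hu huW))
    obtain ⟨w, hw, hwn⟩ := hnear (m - h) (by omega)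
    have hle : |q - gIter S.g (past ω m) h q| ≤ |w - gIter S.g (past ω m) h q| :=
      hgap.abs_sub_le (by linarith)
        ((S.continuousOn_gIter _ h).mono (hjab.trans (S.isub_subset_dom j))) hqφ hv hφv
        ((S.spread_le_spread (past ω m) h hjab hv hqab).trans_lt (hspr _ h)) hw
    have hback : |S.f^[m - h] x - q| < ε / 4 + 2 * S.spread (past ω m) h (S.f^[m] x) q := by
      rw [spread, hφx]
      have h1 := _root_.abs_sub_le w (S.f^[m - h] x) (gIter S.g (past ω m) h q)
      have h2 := _root_.abs_sub_le (S.f^[m - h] x) (gIter S.g (past ω m) h q) q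
      rw [abs_sub_comm w (S.f^[m - h] x)] at h1
      rw [abs_sub_comm (gIter S.g (past ω m) h q) q] at h2
      linarith
    have hhN : N < h := by
      by_contra hle
      have hlen := S.spread_le_len (past ω m) h hab'.le hjab
      have h1 : S.spread (past ω m) h (S.f^[m] x) q * δ ≤ (ε₁ / 4) * δ := by
        have h3 := mul_le_mul_of_nonneg_left hlen hC0.le
        have h2 : C * S.spread (past ω m) h a b * |S.f^[m] x - q| ≤ C * S.len * ε :=
          mul_le_mul h3 hmq.le (abs_nonneg _) (by positivity)
        linarith
      have h2 := le_of_mul_le_mul_right h1 hδ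
      have h3 := hret (m - h) (by linarith) h hh1 (by omega)
      rw [Nat.sub_add_cancel (by omega)] at h3
      linarith
    obtain ⟨hφη, hφC⟩ := hN (past ω m) h hhN.le
    have hclose : |S.f^[m - h] x - q| < ε := by
      have h1 : S.spread (past ω m) h (S.f^[m] x) q * δ ≤ (ε / 8) * δ := by
        have h2 : 8 * C * S.spread (past ω m) h a b * |S.f^[m] x - q| ≤ δ * ε :=
          mul_le_mul hφC hmq.le (abs_nonneg _) hδ.le
        linarith
      have h2 := le_of_mul_le_mul_right h1 hδ
      linarith
    have hK := ih (m - h) (by omega) hclose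
    have hmem : ∀ u ∈ Icc a b, gIter S.g (past ω m) h u ∈ Icc (a - η) (b + η) := by
      intro u hu
      have h1 := abs_sub_lt_iff.1 ((S.spread_le_spread (past ω m) h hjab hv hu).trans_lt hφη)
      constructor <;> linarith [hφv.1, hφv.2]
    have htail : ∀ k ∈ Finset.range (m - h - n₀), S.spread (past ω m) (h + k) a b ≤
        (1 / 8) * S.spread (past ω (m - h)) k a b := by
      intro k hk
      have hk := Finset.mem_range.1 hk
      rw [spread_add, past_add]
      have h1 := hΘ.sum_spread_collar_le hab' hη.le hj hK hηC' hk.le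
      have h2 := hΘ.spread_mul_le hj h1 (hmem a ha) (hmem b hb) (hsub ha) (hsub hb)
      rw [← hC, abs_sub_comm a b, hab, abs_of_pos hδ] at h2
      refine le_of_mul_le_mul_right (h2.trans ?_) hδ
      have h3 := mul_le_mul_of_nonneg_left hφC (S.spread_nonneg (past ω (m - h)) k a b)
      rw [show |gIter S.g (past ω m) h a - gIter S.g (past ω m) h b| =
        S.spread (past ω m) h a b from rfl]
      linarith
    rw [show m - n₀ = h + (m - h - n₀) by omega, Finset.sum_range_add]
    have htot := Finset.sum_le_sum htail
    rw [← Finset.mul_sum] at htot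
    linarith

end

section

variable {p : ℕ} {S : ExpansiveMarkovSystem p} {ω : ℕ → Fin p} {x Θ : ℝ}

/-- If the orbit of `x` accumulates at a non-periodic point adjacent to a gap of the set of limit
points, then `x` belongs to `H`. -/
theorem IsCode.mem_hypSet_of_gap (hω : S.IsCode ω x) (hx : x ∈ S.limitSet) {q d : ℝ}
    (hq : q ∈ S.limitPts x) (hper : ∀ h, 1 ≤ h → S.f^[h] q ≠ q) (hd : 0 < d)
    (hgap : (∀ w ∈ S.limitPts x, w ∉ Ioo q (q + d)) ∨ ∀ w ∈ S.limitPts x, w ∉ Ioo (q - d) q) :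
    x ∈ S.hypSet := by
  obtain ⟨Θ, hΘ⟩ := S.exists_isDistortionConst
  obtain ⟨j, hqj, -⟩ := S.exists_index (hω.limitPts_subset hq)
  obtain ⟨δ₁, hδ₁, hj⟩ := S.exists_closedBall_subset hqj
  obtain ⟨δ₂, hδ₂, heq⟩ := S.exists_equicontinuous (by positivity : 0 < d / 4)
  have hL := S.len_pos
  obtain ⟨C, hC⟩ : ∃ C, C = Real.exp (Θ * (3 * (2 * S.len))) := ⟨_, rfl⟩
  have hC1 : 1 ≤ C := by
    rw [hC]
    exact Real.one_le_exp (mul_nonneg hΘ.1 (by positivity))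
  have hC0 : 0 < C := by linarith
  obtain ⟨δ, hδ, hδd, hδ₂', hδ₁'⟩ : ∃ δ, 0 < δ ∧ δ ≤ d / 4 ∧ δ ≤ δ₂ ∧ δ ≤ δ₁ / 2 :=
    ⟨min (d / 4) (min δ₂ (δ₁ / 2)), by positivity, min_le_left _ _,
      (min_le_right _ _).trans (min_le_left _ _), (min_le_right _ _).trans (min_le_right _ _)⟩
  obtain ⟨η, hη, hηC⟩ : ∃ η, 0 < η ∧ C * η = δ := ⟨δ / C, by positivity, by field_simp⟩
  have hηδ : η ≤ δ := by nlinarith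
  obtain ⟨a, b, hab, hgap⟩ : ∃ a b, b - a = δ ∧ IsGapInterval (S.limitPts x) q a b d := by
    rcases hgap with h | h
    · exact ⟨q, q + δ, by ring, Or.inl ⟨rfl, h⟩⟩
    · exact ⟨q - δ, q, by ring, Or.inr ⟨rfl, h⟩⟩
  have hab' : a < b := by linarith
  have hqab := hgap.mem hab'.le
  have hj' : Icc (a - η) (b + η) ⊆ S.Isub j := fun u hu => hj u <| abs_sub_le_iff.2
    ⟨by linarith [hu.2, hqab.1], by linarith [hu.1, hqab.2]⟩
  have haj : a ∈ S.Isub j := hj' ⟨by linarith, by linarith⟩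
  have hbj : b ∈ S.Isub j := hj' ⟨by linarith, by linarith⟩
  obtain ⟨N, hN⟩ := S.exists_spread_lt (by positivity : 0 < min η (δ / (8 * C)))
  obtain ⟨ε₁, hε₁, -, hret⟩ := hω.exists_no_short_return hq hper N one_pos
  obtain ⟨ε, hε, hεε₁, hεη, hεC⟩ : ∃ ε, 0 < ε ∧ ε ≤ ε₁ ∧ ε ≤ η / 2 ∧
      C * S.len * ε ≤ δ * (ε₁ / 4) := by
    refine ⟨min ε₁ (min (η / 2) (δ * (ε₁ / 4) / (C * S.len))), by positivity, min_le_left _ _,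
      (min_le_right _ _).trans (min_le_left _ _), ?_⟩
    rw [← le_div_iff₀' (by positivity)]
    exact (min_le_right _ _).trans (min_le_right _ _)
  obtain ⟨n₀, hn₀⟩ := hω.exists_limitPt_near (by positivity : 0 < ε / 4)
  have hmain := hω.sum_spread_le_two_mul_len hΘ hC hq hper hgap hδ hab hδd hη hj' hηC.le
    (fun α k => heq α k j a haj b hbj (by rwa [abs_sub_comm, hab, abs_of_pos hδ]))
    (fun α k hk => by
      have h := hN α k hk j a haj b hbj
      refine ⟨h.trans_le (min_le_left _ _), ?_⟩
      have h' := (h.trans_le (min_le_right _ _)).le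
      rwa [le_div_iff₀' (by positivity)] at h')
    hret hε hεε₁ (by linarith) hεC hn₀
  refine hω.mem_hypSet hx (ρ := η / 2) (K := 3 * (2 * S.len) + n₀ * S.len) (half_pos hη)
    fun N' => ?_
  obtain ⟨m, hm, hmq⟩ := hq ε hε (max N' n₀)
  have h1 := le_max_left N' n₀
  have h2 := le_max_right N' n₀
  have hlt := abs_sub_lt_iff.1 hmq
  refine ⟨m, by omega, j, a - η, b + η, hj', by linarith [hqab.1], by linarith [hqab.2], ?_⟩
  have hsum := hΘ.sum_spread_collar_le hab' hη.le hj' (hmain m hmq)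
    (by rw [← hC, hηC, hab]) le_rfl
  have hsplit : Finset.range m = Finset.range (m - n₀ + n₀) := by
    rw [Nat.sub_add_cancel (by omega)]
  rw [hsplit, Finset.sum_range_add]
  refine add_le_add hsum ((Finset.sum_le_card_nsmul _ _ S.len fun i _ =>
    S.spread_le_len _ _ (by linarith) hj').trans ?_)
  rw [Finset.card_range, nsmul_eq_mul]

end

section

variable {p : ℕ} {S : ExpansiveMarkovSystem p} {ω : ℕ → Fin p} {x : ℝ}

/-! ### Orbits that are not eventually periodic -/

theorem exists_pos_forall_lt_le (F : ℕ → ℝ) (hF : ∀ i, 0 < F i) (n : ℕ) :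
    ∃ η, 0 < η ∧ ∀ i < n, η ≤ F i := by
  induction n with
  | zero => exact ⟨1, one_pos, fun i hi => by omega⟩
  | succ n ih =>
    obtain ⟨η, hη, h⟩ := ih
    refine ⟨min η (F n), lt_min hη (hF n), fun i hi => ?_⟩
    rcases Nat.lt_succ_iff_lt_or_eq.1 hi with hi | rfl
    exacts [(min_le_left _ _).trans (h i hi), min_le_right _ _]

theorem IsCode.exists_isCode_of_mem_limitPts (hω : S.IsCode ω x) {w : ℝ}
    (hw : w ∈ S.limitPts x) : ∃ ω', S.IsCode ω' w := by
  have h : ∀ n, S.f^[n] w ∈ S.domF := fun n => hω.limitPts_subset (hω.iterate_mem_limitPts hw n)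
  choose i hi _ using fun n => S.exists_index (h n)
  exact ⟨i, fun n => ⟨h n, interior_subset (hi n)⟩⟩

/-- A preimage in the set of limit points of the least limit point is adjacent to a gap. -/
theorem IsCode.exists_gap_of_preimage (hω : S.IsCode ω x) {y q : ℝ} {t : ℕ}
    (hmin : ∀ w ∈ S.limitPts x, y ≤ w) (hy : y ∈ S.limitPts x) (hq : q ∈ S.limitPts x)
    (hqy : S.f^[t] q = y) :
    ∃ d, 0 < d ∧ ((∀ w ∈ S.limitPts x, w ∉ Ioo q (q + d)) ∨
      ∀ w ∈ S.limitPts x, w ∉ Ioo (q - d) q) := by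
  obtain ⟨ω', hω'⟩ := hω.exists_isCode_of_mem_limitPts hq
  obtain ⟨j, hyj, -⟩ := S.exists_index (hω.limitPts_subset hy)
  obtain ⟨δ, hδ, hj⟩ := S.exists_closedBall_subset hyj
  have hIcc : Icc (y - δ) y ⊆ S.Isub j := fun u hu =>
    hj u (abs_sub_le_iff.2 ⟨by linarith [hu.2], by linarith [hu.1]⟩)
  have hφy : gIter S.g (past ω' t) t y = q := by
    rw [← hqy]; exact hω'.gIter_past_self t
  have hdisj : ∀ w ∈ S.limitPts x, w ∉ gIter S.g (past ω' t) t '' Ioo (y - δ) y := by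
    rintro _ hw ⟨u, hu, rfl⟩
    have h := hω.iterate_mem_limitPts hw t
    rw [S.iterate_f_gIter_self _ _ (S.isub_subset_dom j (hIcc (Ioo_subset_Icc_self hu)))] at h
    exact absurd (hmin u h) (not_le.2 hu.2)
  have hsub := S.Ioo_subset_image_gIter (past ω' t) t (by linarith) hIcc
  have hyI : y ∈ Icc (y - δ) y := ⟨by linarith, le_rfl⟩
  have heI : y - δ ∈ Icc (y - δ) y := ⟨le_rfl, by linarith⟩
  have hne : gIter S.g (past ω' t) t (y - δ) ≠ q := fun h => by
    have := S.injOn_gIter _ t (S.isub_subset_dom j (hIcc heI)) (S.isub_subset_dom j (hIcc hyI))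
      (h.trans hφy.symm)
    linarith
  rw [hφy] at hsub
  generalize gIter S.g (past ω' t) t (y - δ) = e at hsub hne
  rcases lt_or_gt_of_ne hne with h | h
  · refine ⟨q - e, by linarith, Or.inr fun w hw hwI => hdisj w hw (hsub ?_)⟩
    rw [min_eq_left h.le, max_eq_right h.le]
    rwa [sub_sub_cancel] at hwI
  · refine ⟨e - q, by linarith, Or.inl fun w hw hwI => hdisj w hw (hsub ?_)⟩
    rw [min_eq_right h.le, max_eq_left h.le]
    rwa [add_sub_cancel] at hwI

/-- If `y` is its only preimage under `fᵗ` among the limit points, then the orbit of `x` can only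
approach `y` along the orbit of `y`. -/
theorem IsCode.near_of_unique_preimage (hω : S.IsCode ω x) {y : ℝ} {t : ℕ}
    (huniq : ∀ w ∈ S.limitPts x, S.f^[t] w = y → w = y) {ε' : ℝ} (hε' : 0 < ε') :
    ∃ ε, 0 < ε ∧ ∃ n₀, ∀ m, n₀ ≤ m → |S.f^[m + t] x - y| < ε → |S.f^[m] x - y| < ε' := by
  by_contra! h
  choose m hm hmt hfar using fun k : ℕ => h (1 / ((k : ℝ) + 1)) Nat.one_div_pos_of_nat k
  obtain ⟨w, hw, φ, hφ, hlim⟩ := hω.exists_tendsto hm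
  have hwy : w ≠ y := by
    rintro rfl
    obtain ⟨K, hK⟩ := Metric.tendsto_atTop.1 hlim ε' hε'
    exact absurd (hK K le_rfl) (not_lt.2 (hfar (φ K)))
  refine hwy (huniq w hw ?_)
  by_contra hne
  have hpos := half_pos (abs_pos.2 (sub_ne_zero.2 hne))
  obtain ⟨δ, hδ, hc⟩ := hω.continuousAt_iterate hw t _ hpos
  obtain ⟨K, hK⟩ := Metric.tendsto_atTop.1 hlim δ hδ
  obtain ⟨K', hK'⟩ := exists_nat_one_div_lt hpos
  have h1 := hc _ (hK (max K K') (le_max_left _ _))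
  have h2 := hmt (φ (max K K'))
  have h3 : 1 / ((φ (max K K') : ℝ) + 1) ≤ 1 / ((K' : ℝ) + 1) :=
    Nat.one_div_le_one_div ((le_max_right _ _).trans (hφ.id_le _))
  have h4 := abs_sub_le (S.f^[t] w) (S.f^[m (φ (max K K')) + t] x) y
  rw [abs_sub_comm (S.f^[t] w) (S.f^[m (φ (max K K')) + t] x)] at h4
  linarith

theorem IsCode.exists_iterate_eq_of_unique_preimage (hω : S.IsCode ω x) {y : ℝ} {t : ℕ}
    (ht : 1 ≤ t) (hy : y ∈ S.limitPts x) (hper : S.f^[t] y = y)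
    (huniq : ∀ w ∈ S.limitPts x, S.f^[t] w = y → w = y) : ∃ n, S.f^[n] x = y := by
  by_contra! hne
  obtain ⟨ω', hω'⟩ := hω.exists_isCode_of_mem_limitPts hy
  -- the itinerary of a point of the orbit close to `y` agrees with that of `y`
  have hitin : ∀ i, ∃ δ, 0 < δ ∧ ∀ n, |S.f^[n] x - y| < δ → ω (n + i) = ω' i := by
    intro i
    obtain ⟨ε, hε, hj⟩ := S.exists_closedBall_subset (hω'.mem_interior i)
    obtain ⟨δ, hδ, h⟩ := hω.continuousAt_iterate hy i ε hε
    exact ⟨δ, hδ, fun n hn => S.eq_of_mem_isub (hω _).2 (hj _ (h n hn).le)⟩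
  choose F hF hitin using hitin
  obtain ⟨ε', hε', hFε⟩ := exists_pos_forall_lt_le F hF t
  obtain ⟨ε, hε, n₀, hback⟩ := hω.near_of_unique_preimage huniq hε'
  obtain ⟨δ₂, hδ₂, heq⟩ := S.exists_equicontinuous hε
  obtain ⟨δ₁, hδ₁, hj⟩ := S.exists_closedBall_subset (hω'.mem_interior 0)
  obtain ⟨η, hη, hηF⟩ := exists_pos_forall_lt_le (fun n => |S.f^[n] x - y|)
    (fun n => abs_pos.2 (sub_ne_zero.2 (hne n))) (n₀ + t)
  obtain ⟨N, hN⟩ := S.exists_spread_lt hη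
  obtain ⟨m, hm, hmy⟩ := hy (min δ₁ δ₂) (lt_min hδ₁ hδ₂) (n₀ + t * N)
  obtain ⟨r, s, hr, hs, rfl⟩ : ∃ r s, r < t ∧ N ≤ s ∧ m = n₀ + r + t * s := by
    refine ⟨(m - n₀) % t, (m - n₀) / t, Nat.mod_lt _ ht, ?_, ?_⟩
    · rw [Nat.le_div_iff_mul_le ht, mul_comm]; omega
    · have := Nat.mod_add_div (m - n₀) t
      omega
  have hmj := hj _ (hmy.le.trans (min_le_left _ _))
  have hyj : y ∈ S.Isub (ω' 0) := (hω' 0).2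
  have hper0 : S.f^[t] (S.f^[0] y) = S.f^[0] y := hper
  have hyy : ∀ l ≤ s, gIter S.g (past ω' (0 + t * s)) (t * l) y = y := by
    intro l
    induction l with
    | zero => intro; rfl
    | succ l ih =>
      intro h
      rw [hω'.gIter_past_of_periodic hper0 h, ih (by omega), zero_add]
      have := hω'.gIter_past_self t
      rwa [hper] at this
  have hshadow : ∀ l ≤ s, gIter S.g (past ω' (0 + t * s)) (t * l) (S.f^[n₀ + r + t * s] x) =
      S.f^[n₀ + r + t * (s - l)] x := by
    intro l
    induction l with
    | zero => intro; rfl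
    | succ l ih =>
      intro h
      have ih := ih (by omega)
      have hsl : n₀ + r + t * (s - l) = n₀ + r + t * (s - (l + 1)) + t := by
        rw [show s - l = s - (l + 1) + 1 by omega, mul_add, mul_one]; ring
      rw [hsl] at ih
      have hclose := heq (past ω' (0 + t * s)) (t * l) _ _ hmj y hyj
        (hmy.le.trans (min_le_right _ _))
      rw [spread, ih, hyy l (by omega)] at hclose
      have hclose' := hback _ (by omega) hclose
      rw [hω'.gIter_past_of_periodic hper0 h, ih, zero_add]
      have hpast := hω.gIter_past (m := n₀ + r + t * (s - (l + 1)) + t) (k := t) (by omega)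
      rw [Nat.add_sub_cancel] at hpast
      rw [← hpast]
      refine gIter_congr _ (fun i hi => ?_) _
      rw [past, past, ← hitin (t - 1 - i) _ (hclose'.trans_le (hFε _ (by omega)))]
      exact congrArg ω (by omega)
  have h1 := hN (past ω' (0 + t * s)) (t * s) (hs.trans (Nat.le_mul_of_pos_left s ht)) _ _ hmj y hyj
  rw [spread, hshadow s le_rfl, hyy s le_rfl, Nat.sub_self, mul_zero, add_zero] at h1
  exact absurd h1 (not_lt.2 (hηF (n₀ + r) (by omega)))

theorem IsCode.mem_hypSet_of_not_periodic (hω : S.IsCode ω x) (hx : x ∈ S.limitSet)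
    (hnp : ∀ k t, 1 ≤ t → S.f^[t] (S.f^[k] x) ≠ S.f^[k] x) : x ∈ S.hypSet := by
  have hcpt : IsCompact (S.limitPts x) :=
    S.isCompact_domF.of_isClosed_subset isClosed_limitPts hω.limitPts_subset
  obtain ⟨y, hy, hmin⟩ := hcpt.exists_isLeast hω.limitPts_nonempty
  by_cases hper : ∀ h, 1 ≤ h → S.f^[h] y ≠ y
  · exact hω.mem_hypSet_of_gap hx hy hper one_pos
      (Or.inr fun w hw hwI => absurd (hmin hw) (not_le.2 hwI.2))
  push Not at hper
  obtain ⟨t, ht, hty⟩ := hper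
  by_cases huniq : ∀ w ∈ S.limitPts x, S.f^[t] w = y → w = y
  · obtain ⟨n, rfl⟩ := hω.exists_iterate_eq_of_unique_preimage ht hy hty huniq
    exact absurd hty (hnp n t ht)
  push Not at huniq
  obtain ⟨q, hq, hqy, hne⟩ := huniq
  obtain ⟨d, hd, hgap⟩ := hω.exists_gap_of_preimage (fun w hw => hmin hw) hy hq hqy
  refine hω.mem_hypSet_of_gap hx hq (fun h hh hqq => hne ?_) hd hgap
  have h1 : S.f^[h * t] q = q := by
    rw [Function.iterate_mul]; exact Function.iterate_fixed hqq t
  have h2 : S.f^[t * (h - 1)] y = y := by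
    rw [Function.iterate_mul]; exact Function.iterate_fixed hty _
  rw [← h1, show h * t = t * (h - 1) + t by
    obtain ⟨h, rfl⟩ := Nat.exists_eq_add_of_le' hh
    rw [Nat.add_sub_cancel]; ring, Function.iterate_add_apply, hqy, h2]

end

end ExpansiveMarkovSystem

/-- A point `x ∈ Λ_Q` belongs to `Λ_Q \ H` if and only if there exists
`k ≥ 0` such that `f^k(x)` is a parabolic periodic point of `f`. -/
theorem mem_compl_hypSet_iff_parabolic {p : ℕ} (S : ExpansiveMarkovSystem p)
    (x : ℝ) (hx : x ∈ S.limitSet) :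
    x ∈ S.limitSet \ S.hypSet ↔ ∃ k : ℕ, S.IsParabolicPeriodic (S.f^[k] x) := by
  obtain ⟨⟨ω, hω⟩, hlim⟩ := S.exists_isCode hx
  constructor
  · rintro ⟨-, hxH⟩
    by_cases hnp : ∀ k t, 1 ≤ t → S.f^[t] (S.f^[k] x) ≠ S.f^[k] x
    · exact absurd (hω.mem_hypSet_of_not_periodic hx hnp) hxH
    push Not at hnp
    obtain ⟨k, t, ht, hper⟩ := hnp
    exact ⟨k, hlim k, t, ht, hper, not_not.1 fun hder =>
      hxH (hω.mem_hypSet_of_periodic hx ht hper hder)⟩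
  · rintro ⟨k, -, t, ht, hper, hder⟩
    obtain ⟨B, -, hB⟩ := ExpansiveMarkovSystem.exists_derIter_le_of_parabolic ht hper hder
    exact ⟨hx, ExpansiveMarkovSystem.not_mem_hypSet_of_derIter_le hB⟩
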